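/- arXiv:1003.1189 — 2 statements merged into one kernel-verified Lean document; each statement's English description precedes it below -/
import Mathlib

section
/- In the density estimation model, assume ‖f‖_{μ,∞} ≤ L and that β > 0 satisfies (β − 2R²) e^{−4R(L+√L)/β} ≥ 2L + 4RL. Then the mirror averaging aggregate f̂_n based on the sparsity prior (parameters M ≥ 2, τ > 0, R > 2Mτ) satisfies: E_f[‖f̂_n − f‖²_{μ,2}] ≤ inf over λ* with ‖λ*‖₁ ≤ R − 2Mτ of { ‖f_{λ*} − f‖²_{μ,2} + (4β/(n+1)) ∑_{j=1}^M log(1 + τ⁻¹|λ*_j|) } + 4τ²M + β/(n+1). -/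
open MeasureTheory

namespace MirrorAveraging

open ProbabilityTheory

/-- Weighted Cauchy-Schwarz inequality for integrals. -/
theorem sq_integral_mul_le {X : Type*} [MeasurableSpace X] {μ : Measure X} {ρ A B : X → ℝ}
    (hρ : ∀ x, 0 ≤ ρ x) (hA : Integrable (fun x => ρ x * A x ^ 2) μ)
    (hAB : Integrable (fun x => ρ x * (A x * B x)) μ)
    (hB : Integrable (fun x => ρ x * B x ^ 2) μ) :
    (∫ x, ρ x * (A x * B x) ∂μ) ^ 2 ≤ (∫ x, ρ x * A x ^ 2 ∂μ) * ∫ x, ρ x * B x ^ 2 ∂μ := by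
  have key : ∀ t : ℝ, 0 ≤ (∫ x, ρ x * A x ^ 2 ∂μ) * (t * t) +
      (2 * ∫ x, ρ x * (A x * B x) ∂μ) * t + ∫ x, ρ x * B x ^ 2 ∂μ := by
    intro t
    have h : 0 ≤ ∫ x, ρ x * (t * A x + B x) ^ 2 ∂μ :=
      integral_nonneg fun x => mul_nonneg (hρ x) (sq_nonneg _)
    have e : (fun x => ρ x * (t * A x + B x) ^ 2) = fun x =>
        (t * t) * (ρ x * A x ^ 2) + (2 * t) * (ρ x * (A x * B x)) + ρ x * B x ^ 2 := by
      ext x; ring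
    have i1 : Integrable (fun x => (t * t) * (ρ x * A x ^ 2) + (2 * t) * (ρ x * (A x * B x))) μ :=
      (hA.const_mul _).add (hAB.const_mul _)
    rw [e, integral_add i1 hB,
      integral_add (hA.const_mul _) (hAB.const_mul _), integral_const_mul,
      integral_const_mul] at h
    linarith
  have := discrim_le_zero key
  rw [discrim] at this
  nlinarith

/-- The operator bound behind the exponential concavity of the density loss. -/
theorem integral_mul_sub_sq_le {X : Type*} [MeasurableSpace X] {μ : Measure X}
    {f w g v : X → ℝ} {L W G R C a : ℝ}
    (hL : 0 ≤ L) (hf : Integrable f μ) (hf0 : ∀ x, 0 ≤ f x)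
    (hfL : ∀ᵐ x ∂μ, |f x| ≤ L)
    (hw : Measurable w) (hw0 : ∀ x, 0 ≤ w x) (hwW : ∀ x, w x ≤ W)
    (hg : Measurable g) (hgG : ∀ x, |g x| ≤ G) (hg2 : Integrable (fun x => g x ^ 2) μ)
    (hgR : ∫ x, g x ^ 2 ∂μ ≤ R ^ 2)
    (hv : Measurable v) (hvC : ∀ x, |v x| ≤ C) (hv2 : Integrable (fun x => v x ^ 2) μ)
    (ha : a = ∫ x, g x * v x ∂μ) :
    ∫ x, f x * (w x * (v x - a) ^ 2) ∂μ ≤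
      (∫ x, v x ^ 2 ∂μ) * (L * W + (2 * G + R ^ 2) * ∫ x, f x * w x ∂μ) := by
  by_cases hX : IsEmpty X
  · have : μ = 0 := Measure.eq_zero_of_isEmpty μ
    simp [this]
  rw [not_isEmpty_iff] at hX
  obtain ⟨x₀⟩ := hX
  have hG0 : 0 ≤ G := (abs_nonneg _).trans (hgG x₀)
  have hC0 : 0 ≤ C := (abs_nonneg _).trans (hvC x₀)
  have hW0 : 0 ≤ W := (hw0 x₀).trans (hwW x₀)
  have bdd : ∀ (h : X → ℝ) (K : ℝ), Measurable h → (∀ x, |h x| ≤ K) →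
      Integrable (fun x => f x * h x) μ := fun h K hm hb =>
    hf.mul_bdd (c := K) hm.aestronglyMeasurable (Filter.Eventually.of_forall hb)
  set k : X → ℝ := fun x => v x - a with hk
  have hkm : Measurable k := hv.sub_const a
  have hkC : ∀ x, |k x| ≤ C + |a| := fun x => (abs_sub _ _).trans (by gcongr; exact hvC x)
  have hwW' : ∀ x, |w x| ≤ W := fun x => by rw [abs_of_nonneg (hw0 x)]; exact hwW x
  set K := C + |a| with hKdef
  have hK0 : 0 ≤ K := by positivity
  -- integrability of the products
  have i_w : Integrable (fun x => f x * w x) μ := bdd w W hw hwW'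
  have i_wk : Integrable (fun x => f x * (w x * k x)) μ := bdd _ (W * K) (hw.mul hkm) fun x => by
    rw [abs_mul]; exact mul_le_mul (hwW' x) (hkC x) (abs_nonneg _) hW0
  have i_wak : Integrable (fun x => f x * (w x * |k x|)) μ :=
    bdd _ (W * K) (hw.mul hkm.abs) fun x => by
      rw [abs_mul, abs_abs]; exact mul_le_mul (hwW' x) (hkC x) (abs_nonneg _) hW0
  have i_wk2 : Integrable (fun x => f x * (w x * k x ^ 2)) μ :=
    bdd _ (W * K ^ 2) (hw.mul (hkm.pow_const 2)) fun x => by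
      rw [abs_mul, abs_pow]
      exact mul_le_mul (hwW' x) (by gcongr; exact hkC x) (by positivity) hW0
  have i_wkg : Integrable (fun x => f x * (w x * k x * g x)) μ :=
    bdd _ (W * K * G) ((hw.mul hkm).mul hg) fun x => by
      rw [abs_mul, abs_mul]
      exact mul_le_mul (mul_le_mul (hwW' x) (hkC x) (abs_nonneg _) hW0) (hgG x) (abs_nonneg _)
        (by positivity)
  have i_wkv : Integrable (fun x => f x * (w x * k x * v x)) μ :=
    bdd _ (W * K * C) ((hw.mul hkm).mul hv) fun x => by
      rw [abs_mul, abs_mul]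
      exact mul_le_mul (mul_le_mul (hwW' x) (hkC x) (abs_nonneg _) hW0) (hvC x) (abs_nonneg _)
        (by positivity)
  have hfwk_meas : AEStronglyMeasurable (fun x => f x * (w x * k x)) μ := i_wk.1
  have i_sq : Integrable (fun x => (f x * (w x * k x)) ^ 2) μ := by
    refine (i_wk2.const_mul (L * W)).mono' (hfwk_meas.pow 2) ?_
    filter_upwards [hfL] with x hx
    rw [Real.norm_of_nonneg (sq_nonneg _)]
    rw [abs_of_nonneg (hf0 x)] at hx
    have : (f x * (w x * k x)) ^ 2 = (f x * w x) * (f x * (w x * k x ^ 2)) := by ring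
    rw [this]
    have h0 : 0 ≤ f x * (w x * k x ^ 2) := mul_nonneg (hf0 x) (mul_nonneg (hw0 x) (sq_nonneg _))
    exact mul_le_mul_of_nonneg_right
      (mul_le_mul hx (hwW x) (hw0 x) ((hf0 x).trans hx)) h0
  have i_gv : Integrable (fun x => g x * v x) μ :=
    MemLp.integrable_mul ((memLp_two_iff_integrable_sq hg.aestronglyMeasurable).2 hg2)
      ((memLp_two_iff_integrable_sq hv.aestronglyMeasurable).2 hv2)
  set I := ∫ x, f x * (w x * k x ^ 2) ∂μ with hI
  set m := ∫ x, f x * (w x * k x) ∂μ with hm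
  set b := ∫ x, f x * (w x * |k x|) ∂μ with hb
  set E := ∫ x, f x * w x ∂μ with hE
  set V := ∫ x, v x ^ 2 ∂μ with hV
  have hI0 : 0 ≤ I := integral_nonneg fun x =>
    mul_nonneg (hf0 x) (mul_nonneg (hw0 x) (sq_nonneg _))
  have hE0 : 0 ≤ E := integral_nonneg fun x => mul_nonneg (hf0 x) (hw0 x)
  have hV0 : 0 ≤ V := integral_nonneg fun x => sq_nonneg _
  have hmb : |m| ≤ b := by
    refine abs_integral_le_integral_abs.trans (le_of_eq (integral_congr_ae ?_))
    filter_upwards with x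
    rw [abs_mul, abs_mul, abs_of_nonneg (hf0 x), abs_of_nonneg (hw0 x)]
  have hb0 : 0 ≤ b := (abs_nonneg _).trans hmb
  have hb2 : b ^ 2 ≤ E * I := by
    have := sq_integral_mul_le (μ := μ) (ρ := fun x => f x * w x) (A := fun _ => 1)
      (B := fun x => |k x|) (fun x => mul_nonneg (hf0 x) (hw0 x)) (by simpa using i_w)
      (by simpa [mul_assoc] using i_wak) (by simpa [mul_assoc] using i_wk2)
    simpa [mul_assoc] using this
  have hcross : |∫ x, f x * (w x * k x * g x) ∂μ| ≤ G * b := by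
    refine abs_integral_le_integral_abs.trans ?_
    rw [hb, ← integral_const_mul]
    refine integral_mono i_wkg.abs (i_wak.const_mul _) fun x => ?_
    simp only [abs_mul, abs_of_nonneg (hf0 x), abs_of_nonneg (hw0 x)]
    have h0 : 0 ≤ f x * (w x * |k x|) := mul_nonneg (hf0 x) (mul_nonneg (hw0 x) (abs_nonneg _))
    nlinarith [mul_le_mul_of_nonneg_left (hgG x) h0]
  have hsq : ∫ x, (f x * (w x * k x)) ^ 2 ∂μ ≤ L * W * I := by
    rw [hI, ← integral_const_mul]
    refine integral_mono_ae i_sq (i_wk2.const_mul _) ?_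
    filter_upwards [hfL] with x hx
    rw [abs_of_nonneg (hf0 x)] at hx
    have : (f x * (w x * k x)) ^ 2 = (f x * w x) * (f x * (w x * k x ^ 2)) := by ring
    rw [this]
    have h0 : 0 ≤ f x * (w x * k x ^ 2) := mul_nonneg (hf0 x) (mul_nonneg (hw0 x) (sq_nonneg _))
    exact mul_le_mul_of_nonneg_right
      (mul_le_mul hx (hwW x) (hw0 x) ((hf0 x).trans hx)) h0
  -- the representer of `v ↦ ∫ f w k (v - ⟨g, v⟩)`
  set A : X → ℝ := fun x => f x * (w x * k x) - m * g x with hA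
  have i_A2 : Integrable (fun x => A x ^ 2) μ := by
    have : (fun x => A x ^ 2) = fun x => (f x * (w x * k x)) ^ 2 -
        (2 * m) * (f x * (w x * k x * g x)) + m ^ 2 * g x ^ 2 := by ext x; simp only [hA]; ring
    rw [this]
    exact (i_sq.sub (i_wkg.const_mul _)).add (hg2.const_mul _)
  have e_A2 : ∫ x, A x ^ 2 ∂μ ≤ I * (L * W + (2 * G + R ^ 2) * E) := by
    have : (fun x => A x ^ 2) = fun x => (f x * (w x * k x)) ^ 2 -
        (2 * m) * (f x * (w x * k x * g x)) + m ^ 2 * g x ^ 2 := by ext x; simp only [hA]; ring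
    have i1 : Integrable (fun x => (f x * (w x * k x)) ^ 2 -
        (2 * m) * (f x * (w x * k x * g x))) μ := i_sq.sub (i_wkg.const_mul _)
    rw [this, integral_add i1 (hg2.const_mul _),
      integral_sub i_sq (i_wkg.const_mul _), integral_const_mul, integral_const_mul]
    have h1 : -(m * ∫ x, f x * (w x * k x * g x) ∂μ) ≤ G * b ^ 2 := by
      refine (neg_le_abs _).trans ?_
      rw [abs_mul]
      calc _ ≤ b * (G * b) := mul_le_mul hmb hcross (abs_nonneg _) hb0
        _ = _ := by ring
    have h2 : m ^ 2 ≤ b ^ 2 := by rw [← sq_abs]; gcongr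
    have h3 : m ^ 2 * ∫ x, g x ^ 2 ∂μ ≤ b ^ 2 * R ^ 2 :=
      mul_le_mul h2 hgR (integral_nonneg fun x => sq_nonneg _) (sq_nonneg _)
    have h4 : (2 * G + R ^ 2) * b ^ 2 ≤ (2 * G + R ^ 2) * (E * I) := by gcongr
    nlinarith
  have i_Av : Integrable (fun x => A x * v x) μ := by
    have : (fun x => A x * v x) = fun x => f x * (w x * k x * v x) - m * (g x * v x) := by
      ext x; simp only [hA]; ring
    rw [this]
    exact i_wkv.sub (i_gv.const_mul _)
  have e_Av : ∫ x, A x * v x ∂μ = I := by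
    have e1 : (fun x => A x * v x) = fun x => f x * (w x * k x * v x) - m * (g x * v x) := by
      ext x; simp only [hA]; ring
    have e2 : (fun x => f x * (w x * k x ^ 2)) =
        fun x => f x * (w x * k x * v x) - a * (f x * (w x * k x)) := by
      ext x; simp only [hk]; ring
    rw [e1, integral_sub i_wkv (i_gv.const_mul _), integral_const_mul, ← ha, hI, e2,
      integral_sub i_wkv (i_wk.const_mul _), integral_const_mul]
    ring
  have hCS : I ^ 2 ≤ (∫ x, A x ^ 2 ∂μ) * V := by
    have := sq_integral_mul_le (μ := μ) (ρ := fun _ => 1) (A := A) (B := v)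
      (fun _ => zero_le_one) (by simpa using i_A2) (by simpa using i_Av) (by simpa using hv2)
    simpa [e_Av] using this
  have hfin : I * I ≤ I * (V * (L * W + (2 * G + R ^ 2) * E)) := by
    nlinarith [mul_le_mul_of_nonneg_right e_A2 hV0]
  rcases hI0.eq_or_lt with h0 | h0
  · rw [← h0]; positivity
  · exact le_of_mul_le_mul_left hfin h0

theorem exp_integral_le_integral_exp {X : Type*} [MeasurableSpace X] {P : Measure X}
    [IsProbabilityMeasure P] {g : X → ℝ} (hg : Integrable g P)
    (hexp : Integrable (fun x => Real.exp (g x)) P) :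
    Real.exp (∫ x, g x ∂P) ≤ ∫ x, Real.exp (g x) ∂P :=
  convexOn_exp.map_integral_le Real.continuous_exp.continuousOn isClosed_univ
    (Filter.Eventually.of_forall fun _ => Set.mem_univ _) hg hexp

theorem integrable_of_abs_le {X : Type*} [MeasurableSpace X] {P : Measure X}
    [IsFiniteMeasure P] {g : X → ℝ} {C : ℝ} (hg : Measurable g) (hC : ∀ᵐ x ∂P, |g x| ≤ C) :
    Integrable g P :=
  Integrable.of_bound hg.aestronglyMeasurable C hC

theorem integrableExpSet_eq_univ {X : Type*} [MeasurableSpace X] {P : Measure X}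
    [IsFiniteMeasure P] {u : X → ℝ} {C : ℝ} (hu : Measurable u) (hC : ∀ x, |u x| ≤ C) :
    integrableExpSet u P = Set.univ := by
  refine Set.eq_univ_of_forall fun t => ?_
  refine integrable_of_abs_le (C := Real.exp (|t| * C)) (by fun_prop)
    (Filter.Eventually.of_forall fun x => ?_)
  rw [abs_of_pos (Real.exp_pos _)]
  refine Real.exp_le_exp.2 ((le_abs_self _).trans ?_)
  rw [abs_mul]
  exact mul_le_mul_of_nonneg_left (hC x) (abs_nonneg _)

/-- A function with nonpositive second derivative on `[0, 1]` lies below its tangent at `0`. -/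
theorem le_tangent_of_deriv2_nonpos {ψ ψ' ψ'' : ℝ → ℝ} (h1 : ∀ s, HasDerivAt ψ (ψ' s) s)
    (h2 : ∀ s, HasDerivAt ψ' (ψ'' s) s) (h0 : ∀ s ∈ Set.Icc (0 : ℝ) 1, ψ'' s ≤ 0) :
    ψ 1 ≤ ψ 0 + ψ' 0 := by
  have hanti : AntitoneOn ψ' (Set.Icc 0 1) :=
    antitoneOn_of_deriv_nonpos (convex_Icc 0 1)
      (fun s _ => (h2 s).continuousAt.continuousWithinAt)
      (fun s _ => (h2 s).differentiableAt.differentiableWithinAt)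
      fun s hs => by rw [(h2 s).deriv]; exact h0 s (interior_subset hs)
  have hD : ∀ s, HasDerivAt (fun s => ψ s - s * ψ' 0) (ψ' s - 1 * ψ' 0) s := fun s =>
    (h1 s).sub ((hasDerivAt_id s).mul_const _)
  have : AntitoneOn (fun s => ψ s - s * ψ' 0) (Set.Icc 0 1) :=
    antitoneOn_of_deriv_nonpos (convex_Icc 0 1)
      (fun s _ => (hD s).continuousAt.continuousWithinAt)
      (fun s _ => (hD s).differentiableAt.differentiableWithinAt)
      fun s hs => by
        rw [(hD s).deriv]
        have := hanti (Set.left_mem_Icc.2 zero_le_one) (interior_subset hs) (interior_subset hs).1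
        linarith
  have := this (Set.left_mem_Icc.2 zero_le_one) (Set.right_mem_Icc.2 zero_le_one) zero_le_one
  simp only at this
  linarith

/-- The exponential of the loss increment, averaged over the observation, lies below its tangent
along every segment of the dictionary's `ℓ¹` ball. -/
theorem integral_exp_loss_le_tangent {X : Type*} [MeasurableSpace X] {μ P : Measure X}
    [IsProbabilityMeasure P] {f h u : X → ℝ} {L R β : ℝ}
    (hL : 0 ≤ L) (hR : 0 ≤ R) (hβpos : 0 < β)
    (hβ : 2 * L + 4 * R * L ≤
      (β - 2 * R ^ 2) * Real.exp (-(4 * R * (L + Real.sqrt L)) / β))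
    (hf : Integrable f μ) (hf0 : ∀ x, 0 ≤ f x) (hfL : ∀ᵐ x ∂μ, |f x| ≤ L)
    (hP : ∀ g : X → ℝ, ∫ x, g x ∂P = ∫ x, f x * g x ∂μ)
    (hh : Measurable h) (hh2 : Integrable (fun x => h x ^ 2) μ)
    (hu : Measurable u) (hu2 : Integrable (fun x => u x ^ 2) μ)
    (huC : ∀ x, |u x| ≤ 2 * (R * L)) (huR : ∫ x, u x ^ 2 ∂μ ≤ (2 * R) ^ 2)
    (hseg : ∀ s ∈ Set.Icc (0 : ℝ) 1, ∀ x, |h x + s * u x| ≤ R * L)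
    (hsegR : ∀ s ∈ Set.Icc (0 : ℝ) 1, ∫ x, (h x + s * u x) ^ 2 ∂μ ≤ R ^ 2) :
    ∫ x, Real.exp ((-2 * (∫ t, h t * u t ∂μ) - (∫ t, u t ^ 2 ∂μ) + 2 * u x) / β) ∂P ≤
      1 + 2 / β * ((∫ x, u x ∂P) - ∫ t, h t * u t ∂μ) := by
  set b := ∫ t, h t * u t ∂μ with hb
  set V := ∫ t, u t ^ 2 ∂μ with hV
  have hV0 : 0 ≤ V := integral_nonneg fun x => sq_nonneg _
  have i_hu : Integrable (fun x => h x * u x) μ :=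
    MemLp.integrable_mul ((memLp_two_iff_integrable_sq hh.aestronglyMeasurable).2 hh2)
      ((memLp_two_iff_integrable_sq hu.aestronglyMeasurable).2 hu2)
  have hset := integrableExpSet_eq_univ (P := P) hu huC
  have hint : ∀ t, t ∈ interior (integrableExpSet u P) := fun t => by simp [hset]
  set m0 : ℝ → ℝ := fun t => ∫ x, Real.exp (t * u x) ∂P with hm0
  set m1 : ℝ → ℝ := fun t => ∫ x, u x * Real.exp (t * u x) ∂P with hm1
  set m2 : ℝ → ℝ := fun t => ∫ x, u x ^ 2 * Real.exp (t * u x) ∂P with hm2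
  have d0 : ∀ t, HasDerivAt m0 (m1 t) t := fun t => hasDerivAt_mgf (hint t)
  have d1 : ∀ t, HasDerivAt m1 (m2 t) t := fun t => by
    simpa using hasDerivAt_integral_pow_mul_exp_real (hint t) 1
  have i0 : ∀ t, Integrable (fun x => Real.exp (t * u x)) P := fun t => by
    have : t ∈ integrableExpSet u P := by rw [hset]; trivial
    exact this
  have i1 : ∀ t, Integrable (fun x => u x * Real.exp (t * u x)) P := fun t =>
    (i0 t).bdd_mul hu.aestronglyMeasurable (Filter.Eventually.of_forall huC)
  have i2 : ∀ t, Integrable (fun x => u x ^ 2 * Real.exp (t * u x)) P := fun t =>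
    (i0 t).bdd_mul (c := (2 * (R * L)) ^ 2) (hu.pow_const 2).aestronglyMeasurable
      (Filter.Eventually.of_forall fun x => by
        rw [Real.norm_eq_abs, abs_pow]; gcongr; exact huC x)
  set e : ℝ → ℝ := fun s => Real.exp ((-2 * s * b - s ^ 2 * V) / β) with he
  have de : ∀ s, HasDerivAt e (e s * ((-2 * b - 2 * s * V) / β)) s := fun s => by
    have h1 : HasDerivAt (fun s : ℝ => (-2 * s * b - s ^ 2 * V) / β)
        ((-2 * b - 2 * s * V) / β) s := by
      have := ((((hasDerivAt_id s).const_mul (-2)).mul_const b).sub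
        (((hasDerivAt_id s).pow 2).mul_const V)).div_const β
      refine this.congr_deriv ?_
      simp only [id, mul_one, Nat.cast_ofNat]
      ring
    exact h1.exp
  have dlin : ∀ s : ℝ, HasDerivAt (fun s : ℝ => 2 / β * s) (2 / β) s := fun s => by
    simpa using (hasDerivAt_id s).const_mul (2 / β)
  have dm0 : ∀ s, HasDerivAt (fun s => m0 (2 / β * s)) (m1 (2 / β * s) * (2 / β)) s := fun s =>
    (d0 _).comp s (dlin s)
  have dm1 : ∀ s, HasDerivAt (fun s => m1 (2 / β * s)) (m2 (2 / β * s) * (2 / β)) s := fun s =>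
    (d1 _).comp s (dlin s)
  have dq : ∀ s : ℝ,
      HasDerivAt (fun s : ℝ => (-2 * b - 2 * s * V) / β) (-2 * V / β) s := fun s => by
    have := ((((hasDerivAt_id s).const_mul 2).mul_const V).const_sub (-2 * b)).div_const β
    refine this.congr_deriv ?_
    ring
  have hψ := fun s => (de s).mul (dm0 s)
  have hψ' := fun s =>
    (((de s).mul (dq s)).mul (dm0 s)).add ((de s).mul ((dm1 s).mul_const (2 / β)))
  have key := le_tangent_of_deriv2_nonpos hψ hψ' ?_
  · have e1 : (fun x => Real.exp ((-2 * b - V + 2 * u x) / β)) =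
        fun x => e 1 * Real.exp (2 / β * 1 * u x) := by
      ext x
      simp only [he]
      rw [← Real.exp_add]
      congr 1; ring
    rw [e1, integral_const_mul]
    refine key.trans (le_of_eq ?_)
    simp [he, hm0, hm1]
    ring
  · intro s hs
    have hs0 := hs.1
    have hs1 := hs.2
    set t := 2 / β * s with ht
    have ht0 : 0 ≤ t := by positivity
    set a := b + s * V with ha
    have ha' : a = ∫ x, (h x + s * u x) * u x ∂μ := by
      have : (fun x => (h x + s * u x) * u x) = fun x => h x * u x + s * u x ^ 2 := by
        ext x; ring
      rw [this, integral_add i_hu (hu2.const_mul s), integral_const_mul]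
    set W := Real.exp (4 * (R * L) / β) with hW
    have hE : (∫ x, Real.exp (t * u x) * (u x - a) ^ 2 ∂P) = m2 t - 2 * a * m1 t + a ^ 2 * m0 t := by
      have : (fun x => Real.exp (t * u x) * (u x - a) ^ 2) = fun x =>
          (u x ^ 2 * Real.exp (t * u x) - 2 * a * (u x * Real.exp (t * u x))) +
            a ^ 2 * Real.exp (t * u x) := by
        ext x; ring
      have i3 : Integrable (fun x =>
          u x ^ 2 * Real.exp (t * u x) - 2 * a * (u x * Real.exp (t * u x))) P :=
        (i2 t).sub ((i1 t).const_mul _)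
      rw [this, integral_add i3 ((i0 t).const_mul _), integral_sub (i2 t) ((i1 t).const_mul _),
        integral_const_mul, integral_const_mul]
    have i_seg2 : Integrable (fun x => (h x + s * u x) ^ 2) μ := by
      have : (fun x => (h x + s * u x) ^ 2) =
          fun x => h x ^ 2 + 2 * s * (h x * u x) + s ^ 2 * u x ^ 2 := by ext x; ring
      rw [this]
      exact (hh2.add (i_hu.const_mul _)).add (hu2.const_mul _)
    have hw_le : ∀ x, Real.exp (t * u x) ≤ W := fun x => by
      refine Real.exp_le_exp.2 ?_
      have h1 : s * u x ≤ 2 * (R * L) := by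
        have := (le_abs_self _).trans (huC x)
        have h2 : 0 ≤ R * L := by positivity
        nlinarith
      calc t * u x = 2 * (s * u x) / β := by rw [ht]; ring
        _ ≤ 2 * (2 * (R * L)) / β := by gcongr
        _ = _ := by ring
    have hcurv := integral_mul_sub_sq_le (μ := μ) (w := fun x => Real.exp (t * u x)) hL hf hf0 hfL
      (by fun_prop) (fun x => (Real.exp_pos _).le) hw_le (hh.add (hu.const_mul s)) (hseg s hs)
      i_seg2 (hsegR s hs) hu huC hu2 ha'
    rw [← hP, ← hP, hE] at hcurv
    have hm0W : m0 t ≤ W := by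
      calc m0 t ≤ ∫ _, W ∂P := integral_mono (i0 t) (integrable_const _) hw_le
        _ = W := by simp
    have hlow : Real.exp (-(4 * R * Real.sqrt L) / β) ≤ m0 t := by
      have i_u : Integrable u P := integrable_of_abs_le hu (Filter.Eventually.of_forall huC)
      have i_u2 : Integrable (fun x => u x ^ 2) P := by simpa using i2 0
      have h1 : (∫ x, u x ∂P) ^ 2 ≤ ∫ x, u x ^ 2 ∂P := by
        have := sq_integral_mul_le (μ := P) (ρ := fun _ => 1) (A := fun _ => 1) (B := u)
          (fun _ => zero_le_one) (by simp) (by simpa using i_u) (by simpa using i_u2)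
        simpa using this
      have h2 : ∫ x, u x ^ 2 ∂P ≤ L * (2 * R) ^ 2 := by
        have h3 : ∫ x, u x ^ 2 ∂P ≤ L * V := by
          rw [hP, hV, ← integral_const_mul]
          refine integral_mono_of_nonneg (Filter.Eventually.of_forall fun x =>
            mul_nonneg (hf0 x) (sq_nonneg _)) (hu2.const_mul _) ?_
          filter_upwards [hfL] with x hx
          rw [abs_of_nonneg (hf0 x)] at hx
          exact mul_le_mul_of_nonneg_right hx (sq_nonneg _)
        exact h3.trans (by gcongr)
      have h4 : |∫ x, u x ∂P| ≤ 2 * R * Real.sqrt L := by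
        refine abs_le_of_sq_le_sq ?_ (by positivity)
        rw [mul_pow, Real.sq_sqrt hL]
        linarith
      refine le_trans ?_ (exp_integral_le_integral_exp (i_u.const_mul t) (i0 t))
      refine Real.exp_le_exp.2 ?_
      rw [integral_const_mul]
      have h5 : -(2 * R * Real.sqrt L) ≤ s * ∫ x, u x ∂P := by
        have := (abs_le.1 h4).1
        have h6 : 0 ≤ 2 * R * Real.sqrt L := by positivity
        nlinarith
      calc -(4 * R * Real.sqrt L) / β = 2 * (-(2 * R * Real.sqrt L)) / β := by ring
        _ ≤ 2 * (s * ∫ x, u x ∂P) / β := by gcongr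
        _ = _ := by rw [ht]; ring
    have hβ' : (2 * L + 4 * R * L) * W ≤ (β - 2 * R ^ 2) * m0 t := by
      have hsplit : Real.exp (-(4 * R * (L + Real.sqrt L)) / β) * W =
          Real.exp (-(4 * R * Real.sqrt L) / β) := by
        rw [hW, ← Real.exp_add]; congr 1; ring
      have hpos : 0 ≤ β - 2 * R ^ 2 := by
        have h1 : 0 ≤ (β - 2 * R ^ 2) * Real.exp (-(4 * R * (L + Real.sqrt L)) / β) :=
          le_trans (by positivity) hβ
        exact nonneg_of_mul_nonneg_left h1 (Real.exp_pos _)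
      calc _ ≤ ((β - 2 * R ^ 2) * Real.exp (-(4 * R * (L + Real.sqrt L)) / β)) * W := by gcongr
        _ = (β - 2 * R ^ 2) * Real.exp (-(4 * R * Real.sqrt L) / β) := by rw [mul_assoc, hsplit]
        _ ≤ _ := by gcongr
    have hfinal : 2 * (m2 t - 2 * a * m1 t + a ^ 2 * m0 t) ≤ β * V * m0 t := by
      have h1 : L * W + (2 * (R * L) + R ^ 2) * m0 t ≤ β / 2 * m0 t := by
        have : R * L * m0 t ≤ R * L * W := by gcongr
        nlinarith
      calc _ ≤ 2 * (V * (L * W + (2 * (R * L) + R ^ 2) * m0 t)) := by gcongr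
        _ ≤ 2 * (V * (β / 2 * m0 t)) := by gcongr
        _ = _ := by ring
    have hcalc : (e s * ((-2 * b - 2 * s * V) / β) * ((-2 * b - 2 * s * V) / β) + e s * (-2 * V / β)) *
          m0 t + e s * ((-2 * b - 2 * s * V) / β) * (m1 t * (2 / β)) +
        (e s * ((-2 * b - 2 * s * V) / β) * (m1 t * (2 / β)) +
          e s * (m2 t * (2 / β) * (2 / β))) =
        e s * (2 / β ^ 2) * (2 * (m2 t - 2 * a * m1 t + a ^ 2 * m0 t) - β * V * m0 t) := by
      rw [ha]; field_simp; ring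
    refine (le_of_eq hcalc).trans ?_
    exact mul_nonpos_of_nonneg_of_nonpos (by positivity) (by linarith)

/-- The linear combination of the dictionary `φ` with coefficients `l`. -/
noncomputable def lincomb {X : Type*} {M : ℕ} (φ : Fin M → X → ℝ) (l : Fin M → ℝ) (x : X) : ℝ :=
  ∑ j, l j * φ j x

/-- The squared `L²(μ)` norm of a linear combination of the dictionary. -/
noncomputable def energy {X : Type*} [MeasurableSpace X] {M : ℕ} (μ : Measure X)
    (φ : Fin M → X → ℝ) (l : Fin M → ℝ) : ℝ :=
  ∫ x, lincomb φ l x ^ 2 ∂μ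

/-- The empirical loss `‖f_l‖² - 2 f_l(x)` of density estimation. -/
noncomputable def loss {X : Type*} [MeasurableSpace X] {M : ℕ} (μ : Measure X)
    (φ : Fin M → X → ℝ) (l : Fin M → ℝ) (x : X) : ℝ :=
  energy μ φ l - 2 * lincomb φ l x

/-- A normalized dictionary of measurable functions bounded by `L`. -/
structure IsBoundedDictionary {X : Type*} [MeasurableSpace X] {M : ℕ} (μ : Measure X)
    (φ : Fin M → X → ℝ) (L : ℝ) : Prop where
  measurable : ∀ j, Measurable (φ j)
  integral_sq : ∀ j, ∫ x, φ j x ^ 2 ∂μ = 1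
  abs_le : ∀ j x, |φ j x| ≤ L

namespace IsBoundedDictionary

variable {X : Type*} [MeasurableSpace X] {M : ℕ} {μ : Measure X} {φ : Fin M → X → ℝ} {L : ℝ}

theorem integrable_sq (D : IsBoundedDictionary μ φ L) (j : Fin M) :
    Integrable (fun x => φ j x ^ 2) μ := by
  by_contra h
  have := D.integral_sq j
  rw [integral_undef h] at this
  exact zero_ne_one this

theorem memLp (D : IsBoundedDictionary μ φ L) (j : Fin M) : MemLp (φ j) 2 μ :=
  (memLp_two_iff_integrable_sq (D.measurable j).aestronglyMeasurable).2 (D.integrable_sq j)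

theorem integrable_mul (D : IsBoundedDictionary μ φ L) (i j : Fin M) :
    Integrable (fun x => φ i x * φ j x) μ :=
  MemLp.integrable_mul (D.memLp i) (D.memLp j)

theorem measurable_lincomb (D : IsBoundedDictionary μ φ L) :
    Measurable (fun p : (Fin M → ℝ) × X => lincomb φ p.1 p.2) := by
  unfold lincomb
  refine Finset.measurable_sum _ fun j _ => ?_
  exact ((measurable_pi_apply j).comp measurable_fst).mul ((D.measurable j).comp measurable_snd)

theorem measurable_lincomb_right (D : IsBoundedDictionary μ φ L) (l : Fin M → ℝ) :
    Measurable (lincomb φ l) :=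
  D.measurable_lincomb.comp measurable_prodMk_left

theorem memLp_lincomb (D : IsBoundedDictionary μ φ L) (l : Fin M → ℝ) :
    MemLp (lincomb φ l) 2 μ := by
  have : lincomb φ l = fun x => ∑ j, l j * φ j x := rfl
  rw [this]
  exact memLp_finsetSum _ fun j _ => (D.memLp j).const_mul (l j)

theorem integrable_lincomb_sq (D : IsBoundedDictionary μ φ L) (l : Fin M → ℝ) :
    Integrable (fun x => lincomb φ l x ^ 2) μ :=
  (D.memLp_lincomb l).integrable_sq

theorem abs_lincomb_le (D : IsBoundedDictionary μ φ L) (hL : 0 ≤ L) {R : ℝ} {l : Fin M → ℝ}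
    (hl : ∑ j, |l j| ≤ R) (x : X) : |lincomb φ l x| ≤ R * L :=
  calc |lincomb φ l x| ≤ ∑ j, |l j * φ j x| := Finset.abs_sum_le_sum_abs _ _
    _ ≤ ∑ j, |l j| * L := Finset.sum_le_sum fun j _ => by
        rw [abs_mul]; exact mul_le_mul_of_nonneg_left (D.abs_le j x) (abs_nonneg _)
    _ = (∑ j, |l j|) * L := by rw [Finset.sum_mul]
    _ ≤ R * L := by gcongr

theorem energy_eq_sum (D : IsBoundedDictionary μ φ L) (l : Fin M → ℝ) :
    energy μ φ l = ∑ i, ∑ j, l i * l j * ∫ x, φ i x * φ j x ∂μ := by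
  have : (fun x => lincomb φ l x ^ 2) = fun x => ∑ i, ∑ j, l i * l j * (φ i x * φ j x) := by
    ext x
    rw [lincomb, sq, Finset.sum_mul_sum]
    exact Finset.sum_congr rfl fun i _ => Finset.sum_congr rfl fun j _ => by ring
  rw [energy, this, integral_finsetSum _ fun i _ =>
    integrable_finsetSum _ fun j _ => (D.integrable_mul i j).const_mul _]
  refine Finset.sum_congr rfl fun i _ => ?_
  rw [integral_finsetSum _ fun j _ => (D.integrable_mul i j).const_mul _]
  exact Finset.sum_congr rfl fun j _ => integral_const_mul _ _

theorem measurable_energy (D : IsBoundedDictionary μ φ L) : Measurable (energy μ φ) := by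
  have : energy μ φ = fun l => ∑ i, ∑ j, l i * l j * ∫ x, φ i x * φ j x ∂μ :=
    funext D.energy_eq_sum
  rw [this]
  fun_prop

theorem energy_nonneg (l : Fin M → ℝ) : 0 ≤ energy μ φ l :=
  integral_nonneg fun _ => sq_nonneg _

theorem energy_le (D : IsBoundedDictionary μ φ L) {R : ℝ} {l : Fin M → ℝ}
    (hl : ∑ j, |l j| ≤ R) : energy μ φ l ≤ R ^ 2 := by
  have h0 : 0 ≤ ∑ j, |l j| := Finset.sum_nonneg fun _ _ => abs_nonneg _
  have hi : Integrable (fun x => (∑ j, |l j|) * ∑ j, |l j| * φ j x ^ 2) μ :=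
    (integrable_finsetSum _ fun j _ => (D.integrable_sq j).const_mul _).const_mul _
  calc energy μ φ l ≤ ∫ x, (∑ j, |l j|) * ∑ j, |l j| * φ j x ^ 2 ∂μ := by
        refine integral_mono (D.integrable_lincomb_sq l) hi fun x => ?_
        refine Finset.sum_sq_le_sum_mul_sum_of_sq_le_mul _ (fun _ _ => abs_nonneg _)
          (fun _ _ => by positivity) fun j _ => le_of_eq ?_
        rw [mul_pow, ← sq_abs (l j)]
        ring
    _ = (∑ j, |l j|) * ∑ j, |l j| := by
        rw [integral_const_mul,
          integral_finsetSum _ fun j _ => (D.integrable_sq j).const_mul _]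
        simp [integral_const_mul, D.integral_sq]
    _ ≤ R ^ 2 := by rw [sq]; gcongr; exact h0.trans hl

theorem measurable_loss (D : IsBoundedDictionary μ φ L) :
    Measurable (fun p : (Fin M → ℝ) × X => loss μ φ p.1 p.2) :=
  (D.measurable_energy.comp measurable_fst).sub (D.measurable_lincomb.const_mul 2)

theorem measurable_loss_comp (D : IsBoundedDictionary μ φ L) {Y : Type*} [MeasurableSpace Y]
    {g : Y → Fin M → ℝ} {h : Y → X} (hg : Measurable g) (hh : Measurable h) :
    Measurable fun y => loss μ φ (g y) (h y) := by
  unfold loss lincomb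
  refine (D.measurable_energy.comp hg).sub (Measurable.const_mul ?_ 2)
  exact Finset.measurable_sum _ fun j _ =>
    ((measurable_pi_apply j).comp hg).mul ((D.measurable j).comp hh)

theorem measurable_loss_right (D : IsBoundedDictionary μ φ L) (l : Fin M → ℝ) :
    Measurable (loss μ φ l) :=
  ((D.measurable_lincomb_right l).const_mul 2).const_sub _

theorem measurable_loss_left (D : IsBoundedDictionary μ φ L) (x : X) :
    Measurable (fun l => loss μ φ l x) := by
  unfold loss lincomb
  exact D.measurable_energy.sub (by fun_prop)

theorem abs_loss_le (D : IsBoundedDictionary μ φ L) (hL : 0 ≤ L) {R : ℝ} {l : Fin M → ℝ}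
    (hl : ∑ j, |l j| ≤ R) (x : X) : |loss μ φ l x| ≤ R ^ 2 + 2 * (R * L) := by
  have h1 := D.abs_lincomb_le hL hl x
  have h2 := D.energy_le hl
  have h3 : 0 ≤ energy μ φ l := energy_nonneg l
  rw [_root_.abs_le] at h1 ⊢
  unfold loss
  constructor <;> nlinarith

end IsBoundedDictionary

theorem integrable_exp_of_abs_le {E : Type*} [MeasurableSpace E] {ρ : Measure E}
    [IsFiniteMeasure ρ] {g : E → ℝ} {C : ℝ} (hg : Measurable g)
    (hC : ∀ᵐ l ∂ρ, |g l| ≤ C) : Integrable (fun l => Real.exp (g l)) ρ := by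
  refine integrable_of_abs_le (C := Real.exp C) (by fun_prop) ?_
  filter_upwards [hC] with l hl
  rw [abs_of_pos (Real.exp_pos _)]
  exact Real.exp_le_exp.2 ((le_abs_self _).trans hl)

theorem abs_log_integral_exp_le {E : Type*} [MeasurableSpace E] {ρ : Measure E}
    [IsProbabilityMeasure ρ] {g : E → ℝ} {C : ℝ} (hg : Measurable g)
    (hC : ∀ᵐ l ∂ρ, |g l| ≤ C) : |Real.log (∫ l, Real.exp (g l) ∂ρ)| ≤ C := by
  have i := integrable_exp_of_abs_le hg hC
  have h1 : Real.exp (-C) ≤ ∫ l, Real.exp (g l) ∂ρ := by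
    calc Real.exp (-C) = ∫ _, Real.exp (-C) ∂ρ := by simp
      _ ≤ _ := integral_mono_ae (integrable_const _) i (by
        filter_upwards [hC] with l hl
        exact Real.exp_le_exp.2 (neg_le_of_abs_le hl))
  have h2 : ∫ l, Real.exp (g l) ∂ρ ≤ Real.exp C := by
    calc _ ≤ ∫ _, Real.exp C ∂ρ := integral_mono_ae i (integrable_const _) (by
          filter_upwards [hC] with l hl
          exact Real.exp_le_exp.2 ((le_abs_self _).trans hl))
      _ = _ := by simp
  have h0 : 0 < ∫ l, Real.exp (g l) ∂ρ := (Real.exp_pos _).trans_le h1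
  rw [abs_le]
  exact ⟨(Real.le_log_iff_exp_le h0).2 h1, (Real.log_le_iff_le_exp h0).2 h2⟩

theorem measurable_log_integral_exp {E Y : Type*} [MeasurableSpace E] [MeasurableSpace Y]
    {ρ : Measure E} [SFinite ρ] {g : Y → E → ℝ} (hg : Measurable (Function.uncurry g)) :
    Measurable fun y => Real.log (∫ l, Real.exp (g y l) ∂ρ) := by
  refine Real.measurable_log.comp ?_
  have : StronglyMeasurable (Function.uncurry fun y l => Real.exp (g y l)) :=
    (Real.measurable_exp.comp hg).stronglyMeasurable
  exact this.integral_prod_right.measurable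

theorem integrable_coord {M : ℕ} {ρ : Measure (Fin M → ℝ)} [IsFiniteMeasure ρ] {R : ℝ}
    (hρ : ∀ᵐ l ∂ρ, ∑ j, |l j| ≤ R) (j : Fin M) : Integrable (fun l : Fin M → ℝ => l j) ρ := by
  refine integrable_of_abs_le (C := R) (measurable_pi_apply j) ?_
  filter_upwards [hρ] with l hl
  exact (Finset.single_le_sum (f := fun j => |l j|) (fun _ _ => abs_nonneg _)
    (Finset.mem_univ j)).trans hl

theorem sum_abs_integral_le {M : ℕ} {ρ : Measure (Fin M → ℝ)} [IsProbabilityMeasure ρ] {R : ℝ}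
    (hρ : ∀ᵐ l ∂ρ, ∑ j, |l j| ≤ R) : ∑ j, |∫ l, l j ∂ρ| ≤ R :=
  calc ∑ j, |∫ l, l j ∂ρ| ≤ ∑ j, ∫ l, |l j| ∂ρ :=
        Finset.sum_le_sum fun _ _ => abs_integral_le_integral_abs
    _ = ∫ l, ∑ j, |l j| ∂ρ :=
        (integral_finsetSum _ fun j _ => (integrable_coord hρ j).abs).symm
    _ ≤ ∫ _, R ∂ρ := integral_mono_ae
        (integrable_finsetSum _ fun j _ => (integrable_coord hρ j).abs) (integrable_const _) hρ
    _ = R := by simp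

/-- `f` is a density of `P` with respect to `μ`, bounded by `L`. -/
structure IsBoundedDensity {X : Type*} [MeasurableSpace X] (μ P : Measure X) (f : X → ℝ)
    (L : ℝ) : Prop where
  integrable : Integrable f μ
  nonneg : ∀ x, 0 ≤ f x
  abs_le : ∀ᵐ x ∂μ, |f x| ≤ L
  integral_eq : ∀ g : X → ℝ, ∫ x, g x ∂P = ∫ x, f x * g x ∂μ

theorem lincomb_add_smul {X : Type*} {M : ℕ} (φ : Fin M → X → ℝ) (h l : Fin M → ℝ) (s : ℝ) (x : X) :
    lincomb φ h x + s * lincomb φ (l - h) x = lincomb φ (h + s • (l - h)) x := by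
  simp only [lincomb, Finset.mul_sum, ← Finset.sum_add_distrib]
  refine Finset.sum_congr rfl fun j _ => ?_
  simp; ring

section OneStep

variable {X : Type*} [MeasurableSpace X] {M : ℕ} {μ P : Measure X} [IsProbabilityMeasure P]
  {φ : Fin M → X → ℝ} {f : X → ℝ} {L R β : ℝ}

theorem integral_exp_loss_sub_le (D : IsBoundedDictionary μ φ L) (F : IsBoundedDensity μ P f L)
    (hL : 0 ≤ L) (hR : 0 ≤ R) (hβpos : 0 < β)
    (hβ : 2 * L + 4 * R * L ≤
      (β - 2 * R ^ 2) * Real.exp (-(4 * R * (L + Real.sqrt L)) / β))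
    {h l : Fin M → ℝ} (hh : ∑ j, |h j| ≤ R) (hl : ∑ j, |l j| ≤ R) :
    ∫ x, Real.exp ((loss μ φ h x - loss μ φ l x) / β) ∂P ≤
      1 + ∑ j, (l j - h j) *
        (2 / β * ((∫ x, φ j x ∂P) - ∫ x, lincomb φ h x * φ j x ∂μ)) := by
  have hu : ∑ j, |(l - h) j| ≤ 2 * R :=
    calc ∑ j, |(l - h) j| ≤ ∑ j, (|l j| + |h j|) := Finset.sum_le_sum fun j _ => abs_sub _ _
      _ ≤ 2 * R := by rw [Finset.sum_add_distrib]; linarith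
  have hs : ∀ s ∈ Set.Icc (0 : ℝ) 1, ∑ j, |(h + s • (l - h)) j| ≤ R := by
    intro s hs
    calc ∑ j, |(h + s • (l - h)) j| ≤ ∑ j, ((1 - s) * |h j| + s * |l j|) := by
          refine Finset.sum_le_sum fun j _ => ?_
          have : (h + s • (l - h)) j = (1 - s) * h j + s * l j := by simp; ring
          rw [this]
          refine (abs_add_le _ _).trans (le_of_eq ?_)
          rw [abs_mul, abs_mul, abs_of_nonneg hs.1, abs_of_nonneg (sub_nonneg.2 hs.2)]
      _ = (1 - s) * ∑ j, |h j| + s * ∑ j, |l j| := by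
          rw [Finset.sum_add_distrib, Finset.mul_sum, Finset.mul_sum]
      _ ≤ (1 - s) * R + s * R := by
          have := sub_nonneg.2 hs.2
          have := hs.1
          gcongr
      _ = R := by ring
  have i_hu : Integrable (fun x => lincomb φ h x * lincomb φ (l - h) x) μ :=
    MemLp.integrable_mul (D.memLp_lincomb h) (D.memLp_lincomb (l - h))
  have key := integral_exp_loss_le_tangent (μ := μ) (P := P) (h := lincomb φ h)
    (u := lincomb φ (l - h)) hL hR hβpos hβ F.integrable F.nonneg F.abs_le F.integral_eq
    (D.measurable_lincomb_right h) (D.integrable_lincomb_sq h)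
    (D.measurable_lincomb_right _) (D.integrable_lincomb_sq _)
    (fun x => by have := D.abs_lincomb_le hL hu x; linarith)
    (D.energy_le hu)
    (fun s hs' x => by rw [lincomb_add_smul]; exact D.abs_lincomb_le hL (hs s hs') x)
    (fun s hs' => by simp only [lincomb_add_smul]; exact D.energy_le (hs s hs'))
  have hone : ∀ x, lincomb φ h x + lincomb φ (l - h) x = lincomb φ l x := fun x => by
    have := lincomb_add_smul φ h l 1 x
    simpa using this
  have henergy : energy μ φ l = energy μ φ h +
      2 * (∫ x, lincomb φ h x * lincomb φ (l - h) x ∂μ) + ∫ x, lincomb φ (l - h) x ^ 2 ∂μ := by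
    have : (fun x => lincomb φ l x ^ 2) = fun x => lincomb φ h x ^ 2 +
        2 * (lincomb φ h x * lincomb φ (l - h) x) + lincomb φ (l - h) x ^ 2 := by
      ext x; rw [← hone]; ring
    have i1 : Integrable (fun x => lincomb φ h x ^ 2 +
        2 * (lincomb φ h x * lincomb φ (l - h) x)) μ :=
      (D.integrable_lincomb_sq h).add (i_hu.const_mul 2)
    rw [energy, this, integral_add i1 (D.integrable_lincomb_sq _),
      integral_add (D.integrable_lincomb_sq h) (i_hu.const_mul 2), integral_const_mul]
    rfl
  have e1 : (fun x => Real.exp ((loss μ φ h x - loss μ φ l x) / β)) = fun x =>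
      Real.exp ((-2 * (∫ t, lincomb φ h t * lincomb φ (l - h) t ∂μ) -
        (∫ t, lincomb φ (l - h) t ^ 2 ∂μ) + 2 * lincomb φ (l - h) x) / β) := by
    ext x
    rw [loss, loss, henergy, ← hone]
    congr 2
    ring
  have e2 : ∫ x, lincomb φ (l - h) x ∂P = ∑ j, (l j - h j) * ∫ x, φ j x ∂P := by
    unfold lincomb
    rw [integral_finsetSum _ fun j _ => (integrable_of_abs_le (D.measurable j)
      (Filter.Eventually.of_forall (D.abs_le j))).const_mul _]
    simp [integral_const_mul]
  have e3 : ∫ x, lincomb φ h x * lincomb φ (l - h) x ∂μ =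
      ∑ j, (l j - h j) * ∫ x, lincomb φ h x * φ j x ∂μ := by
    have : (fun x => lincomb φ h x * lincomb φ (l - h) x) = fun x =>
        ∑ j, (l j - h j) * (lincomb φ h x * φ j x) := by
      ext x
      conv_lhs => rw [lincomb.eq_1 φ (l - h), Finset.mul_sum]
      refine Finset.sum_congr rfl fun j _ => ?_
      simp; ring
    have i1 : ∀ j, Integrable (fun x => lincomb φ h x * φ j x) μ := fun j =>
      MemLp.integrable_mul (D.memLp_lincomb h) (D.memLp j)
    rw [this, integral_finsetSum _ fun j _ => (i1 j).const_mul _]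
    simp [integral_const_mul]
  rw [e1]
  refine key.trans (le_of_eq ?_)
  rw [e2, e3, ← Finset.sum_sub_distrib, Finset.mul_sum]
  congr 1
  exact Finset.sum_congr rfl fun j _ => by ring

theorem integral_integral_exp_loss_sub_le (D : IsBoundedDictionary μ φ L)
    (F : IsBoundedDensity μ P f L)
    (hL : 0 ≤ L) (hR : 0 ≤ R) (hβpos : 0 < β)
    (hβ : 2 * L + 4 * R * L ≤
      (β - 2 * R ^ 2) * Real.exp (-(4 * R * (L + Real.sqrt L)) / β))
    {ρ : Measure (Fin M → ℝ)} [IsProbabilityMeasure ρ] (hρ : ∀ᵐ l ∂ρ, ∑ j, |l j| ≤ R)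
    {h : Fin M → ℝ} (hh : ∀ j, h j = ∫ l, l j ∂ρ) (hhR : ∑ j, |h j| ≤ R)
    (hi : Integrable (fun p : (Fin M → ℝ) × X =>
      Real.exp ((loss μ φ h p.2 - loss μ φ p.1 p.2) / β)) (ρ.prod P)) :
    ∫ l, ∫ x, Real.exp ((loss μ φ h x - loss μ φ l x) / β) ∂P ∂ρ ≤ 1 := by
  have i_c := integrable_coord hρ
  have i_s : ∀ j, Integrable (fun l : Fin M → ℝ => (l j - h j) *
      (2 / β * ((∫ x, φ j x ∂P) - ∫ x, lincomb φ h x * φ j x ∂μ))) ρ := fun j =>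
    ((i_c j).sub (integrable_const _)).mul_const _
  calc ∫ l, ∫ x, Real.exp ((loss μ φ h x - loss μ φ l x) / β) ∂P ∂ρ
      ≤ ∫ l, (1 + ∑ j, (l j - h j) *
          (2 / β * ((∫ x, φ j x ∂P) - ∫ x, lincomb φ h x * φ j x ∂μ))) ∂ρ := by
        refine integral_mono_ae hi.integral_prod_left ((integrable_const _).add
          (integrable_finsetSum _ fun j _ => i_s j)) ?_
        filter_upwards [hρ] with l hl
        exact integral_exp_loss_sub_le D F hL hR hβpos hβ hhR hl
    _ = 1 := by
        rw [integral_add (integrable_const _) (integrable_finsetSum _ fun j _ => i_s j),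
          integral_finsetSum _ fun j _ => i_s j]
        have : ∀ j, ∫ l : Fin M → ℝ, (l j - h j) *
            (2 / β * ((∫ x, φ j x ∂P) - ∫ x, lincomb φ h x * φ j x ∂μ)) ∂ρ = 0 := fun j => by
          rw [integral_mul_const, integral_sub (i_c j) (integrable_const _)]
          simp [hh j]
        simp [this]

/-- The risk of the barycentre of `ρ` is at most the expected increment of the log-partition
function. -/
theorem integral_loss_barycentre_le (D : IsBoundedDictionary μ φ L)
    (F : IsBoundedDensity μ P f L)
    (hL : 0 ≤ L) (hR : 0 ≤ R) (hβpos : 0 < β)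
    (hβ : 2 * L + 4 * R * L ≤
      (β - 2 * R ^ 2) * Real.exp (-(4 * R * (L + Real.sqrt L)) / β))
    {ρ : Measure (Fin M → ℝ)} [IsProbabilityMeasure ρ] (hρ : ∀ᵐ l ∂ρ, ∑ j, |l j| ≤ R)
    {h : Fin M → ℝ} (hh : ∀ j, h j = ∫ l, l j ∂ρ) :
    ∫ x, loss μ φ h x ∂P ≤
      -β * ∫ x, Real.log (∫ l, Real.exp (-loss μ φ l x / β) ∂ρ) ∂P := by
  have hhR : ∑ j, |h j| ≤ R := by simpa only [hh] using sum_abs_integral_le hρ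
  have m_h : Measurable (loss μ φ h) := D.measurable_loss_right h
  have i_h : Integrable (loss μ φ h) P := integrable_of_abs_le m_h
    (Filter.Eventually.of_forall fun x => D.abs_loss_le hL hhR x)
  have b_l : ∀ x, ∀ᵐ l ∂ρ, |-loss μ φ l x / β| ≤ (R ^ 2 + 2 * (R * L)) / β := fun x => by
    filter_upwards [hρ] with l hl
    rw [abs_div, abs_neg, abs_of_pos hβpos]
    gcongr
    exact D.abs_loss_le hL hl x
  have m_uncurry : Measurable (Function.uncurry fun (x : X) (l : Fin M → ℝ) =>
      -loss μ φ l x / β) :=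
    ((D.measurable_loss.comp measurable_swap).neg).div_const β
  have m_l : ∀ x, Measurable fun l => -loss μ φ l x / β := fun x =>
    (D.measurable_loss_left x).neg.div_const β
  have i_log : Integrable (fun x => Real.log (∫ l, Real.exp (-loss μ φ l x / β) ∂ρ)) P :=
    integrable_of_abs_le (measurable_log_integral_exp m_uncurry)
      (Filter.Eventually.of_forall fun x => abs_log_integral_exp_le (m_l x) (b_l x))
  have i_joint : Integrable (fun p : (Fin M → ℝ) × X =>
      Real.exp ((loss μ φ h p.2 - loss μ φ p.1 p.2) / β)) (ρ.prod P) := by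
    refine integrable_exp_of_abs_le (C := 2 * (R ^ 2 + 2 * (R * L)) / β)
      (((m_h.comp measurable_snd).sub D.measurable_loss).div_const β) ?_
    have : ∀ᵐ p ∂(ρ.prod P), ∑ j, |p.1 j| ≤ R := Measure.quasiMeasurePreserving_fst.ae hρ
    filter_upwards [this] with p hp
    have h1 := D.abs_loss_le hL hhR p.2
    have h2 := D.abs_loss_le hL hp p.2
    rw [abs_div, abs_of_pos hβpos]
    gcongr
    exact (abs_sub _ _).trans (by linarith)
  have hY := integral_integral_exp_loss_sub_le D F hL hR hβpos hβ hρ hh hhR i_joint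
  rw [integral_integral_swap (f := fun l x =>
    Real.exp ((loss μ φ h x - loss μ φ l x) / β)) i_joint] at hY
  have i_Y : Integrable (fun x => ∫ l, Real.exp ((loss μ φ h x - loss μ φ l x) / β) ∂ρ) P :=
    i_joint.integral_prod_right
  have eY : ∀ x, ∫ l, Real.exp ((loss μ φ h x - loss μ φ l x) / β) ∂ρ =
      Real.exp (loss μ φ h x / β) * ∫ l, Real.exp (-loss μ φ l x / β) ∂ρ := fun x => by
    rw [← integral_const_mul]
    congr 1
    ext l
    rw [← Real.exp_add]; congr 1; ring
  simp_rw [eY] at hY i_Y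
  generalize hZ : (fun x => ∫ l, Real.exp (-loss μ φ l x / β) ∂ρ) = Z
  have hZ' : ∀ x, ∫ l, Real.exp (-loss μ φ l x / β) ∂ρ = Z x := congrFun hZ
  have Zpos : ∀ x, 0 < Z x := fun x => by
    rw [← hZ']
    exact integral_exp_pos (integrable_exp_of_abs_le (m_l x) (b_l x))
  simp only [hZ'] at hY i_Y i_log ⊢
  have hlog : ∫ x, (loss μ φ h x / β + Real.log (Z x)) ∂P ≤ 0 := by
    calc ∫ x, (loss μ φ h x / β + Real.log (Z x)) ∂P
        ≤ ∫ x, (Real.exp (loss μ φ h x / β) * Z x - 1) ∂P := by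
          refine integral_mono ((i_h.div_const β).add i_log) (i_Y.sub (integrable_const _))
            fun x => ?_
          have h1 := Real.log_le_sub_one_of_pos (mul_pos (Real.exp_pos (loss μ φ h x / β)) (Zpos x))
          rwa [Real.log_mul (Real.exp_pos _).ne' (Zpos x).ne', Real.log_exp] at h1
      _ ≤ 0 := by
          rw [integral_sub i_Y (integrable_const _)]
          simpa using hY
  rw [integral_add (i_h.div_const β) i_log, integral_div] at hlog
  have : (∫ x, loss μ φ h x ∂P) / β ≤ -∫ x, Real.log (Z x) ∂P := by linarith
  rw [div_le_iff₀ hβpos] at this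
  linarith

/-- The one-step bound for a Gibbs posterior with potential `S`. -/
theorem integral_loss_tilted_le (D : IsBoundedDictionary μ φ L)
    (F : IsBoundedDensity μ P f L)
    (hL : 0 ≤ L) (hR : 0 ≤ R) (hβpos : 0 < β)
    (hβ : 2 * L + 4 * R * L ≤
      (β - 2 * R ^ 2) * Real.exp (-(4 * R * (L + Real.sqrt L)) / β))
    {π : Measure (Fin M → ℝ)} [IsProbabilityMeasure π] (hπ : ∀ᵐ l ∂π, ∑ j, |l j| ≤ R)
    {S : (Fin M → ℝ) → ℝ} {C : ℝ} (hS : Measurable S) (hSC : ∀ᵐ l ∂π, |S l| ≤ C) :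
    ∫ x, loss μ φ (fun j => ∫ l, l j ∂(π.tilted fun l => -S l / β)) x ∂P ≤
      -β * ((∫ x, Real.log (∫ l, Real.exp (-(S l + loss μ φ l x) / β) ∂π) ∂P) -
        Real.log (∫ l, Real.exp (-S l / β) ∂π)) := by
  have hSC' : ∀ᵐ l ∂π, |-S l / β| ≤ C / β := by
    filter_upwards [hSC] with l hl
    rw [abs_div, abs_neg, abs_of_pos hβpos]
    gcongr
  have mS : Measurable fun l => -S l / β := hS.neg.div_const β
  have i_S := integrable_exp_of_abs_le mS hSC'
  have : IsProbabilityMeasure (π.tilted fun l => -S l / β) := isProbabilityMeasure_tilted i_S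
  have hac : ∀ᵐ l ∂(π.tilted fun l => -S l / β), ∑ j, |l j| ≤ R :=
    (tilted_absolutelyContinuous _ _).ae_le hπ
  refine (integral_loss_barycentre_le D F hL hR hβpos hβ hac fun _ => rfl).trans (le_of_eq ?_)
  have m_uncurry : Measurable (Function.uncurry fun (x : X) (l : Fin M → ℝ) =>
      -(S l + loss μ φ l x) / β) :=
    (((hS.comp measurable_snd).add (D.measurable_loss.comp measurable_swap)).neg).div_const β
  have b_l : ∀ x, ∀ᵐ l ∂π, |-(S l + loss μ φ l x) / β| ≤ (C + (R ^ 2 + 2 * (R * L))) / β :=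
    fun x => by
      filter_upwards [hπ, hSC] with l hl hl'
      rw [abs_div, abs_neg, abs_of_pos hβpos]
      gcongr
      exact (abs_add_le _ _).trans (add_le_add hl' (D.abs_loss_le hL hl x))
  have m_l : ∀ x, Measurable fun l => -(S l + loss μ φ l x) / β := fun x =>
    (hS.add (D.measurable_loss_left x)).neg.div_const β
  have e : ∀ x, Real.log (∫ l, Real.exp (-loss μ φ l x / β) ∂(π.tilted fun l => -S l / β)) =
      Real.log (∫ l, Real.exp (-(S l + loss μ φ l x) / β) ∂π) -
        Real.log (∫ l, Real.exp (-S l / β) ∂π) := fun x => by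
    rw [← Real.log_div (integral_exp_pos (integrable_exp_of_abs_le (m_l x) (b_l x))).ne'
      (integral_exp_pos i_S).ne', integral_tilted, ← integral_div]
    congr 1
    refine integral_congr_ae (Filter.Eventually.of_forall fun l => ?_)
    simp only [smul_eq_mul]
    rw [div_mul_eq_mul_div, ← Real.exp_add]
    congr 2
    ring
  simp_rw [e]
  rw [integral_sub (integrable_of_abs_le (measurable_log_integral_exp m_uncurry)
    (Filter.Eventually.of_forall fun x => abs_log_integral_exp_le (m_l x) (b_l x)))
    (integrable_const _)]
  simp

end OneStep

theorem measurePreserving_update {ι X : Type*} [Fintype ι] [DecidableEq ι] [MeasurableSpace X]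
    (P : Measure X) [IsProbabilityMeasure P] (i : ι) :
    MeasurePreserving (fun p : (ι → X) × X => Function.update p.1 i p.2)
      ((Measure.pi fun _ : ι => P).prod P) (Measure.pi fun _ => P) := by
  have hm : Measurable (fun p : (ι → X) × X => Function.update p.1 i p.2) := by
    rw [measurable_pi_iff]
    intro j
    by_cases h : j = i
    · subst h; simpa using measurable_snd
    · have : Measurable fun p : (ι → X) × X => p.1 j :=
        (measurable_pi_apply j).comp measurable_fst
      simpa [h] using this
  refine ⟨hm, (Measure.pi_eq fun s hs => ?_).symm⟩
  rw [Measure.map_apply hm (MeasurableSet.univ_pi hs)]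
  have : (fun p : (ι → X) × X => Function.update p.1 i p.2) ⁻¹' (Set.univ.pi s) =
      (Set.univ.pi (Function.update s i Set.univ)) ×ˢ (s i) := by
    ext p
    simp only [Set.mem_preimage, Set.mem_pi, Set.mem_univ, true_imp_iff, Set.mem_prod]
    constructor
    · intro h
      refine ⟨fun j => ?_, by simpa using h i⟩
      by_cases hj : j = i
      · subst hj; simp
      · simpa [hj] using h j
    · rintro ⟨h1, h2⟩ j
      by_cases hj : j = i
      · subst hj; simpa using h2
      · simpa [hj] using h1 j
  rw [this, Measure.prod_prod, Measure.pi_pi, ← Finset.mul_prod_erase _ _ (Finset.mem_univ i),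
    ← Finset.mul_prod_erase _ (fun j => P (s j)) (Finset.mem_univ i)]
  rw [Finset.prod_congr rfl fun j hj => by
    rw [Function.update_of_ne (Finset.ne_of_mem_erase hj)]]
  simp [mul_comm]

/-- The Gibbs posterior mean after observing the points `z i`, `i ∈ s`. -/
noncomputable def posteriorMean {ι X : Type*} [MeasurableSpace X] {M : ℕ} (μ : Measure X)
    (φ : Fin M → X → ℝ) (β : ℝ) (π : Measure (Fin M → ℝ)) (s : Finset ι) (z : ι → X) :
    Fin M → ℝ :=
  fun j => ∫ l, l j ∂(π.tilted fun l => -(∑ i ∈ s, loss μ φ l (z i)) / β)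

section Sample

variable {ι X : Type*} [MeasurableSpace X] {M : ℕ} {μ P : Measure X}
  [IsProbabilityMeasure P] {φ : Fin M → X → ℝ} {f : X → ℝ} {L R β : ℝ}
  {π : Measure (Fin M → ℝ)} [IsProbabilityMeasure π]

theorem measurable_sum_loss (D : IsBoundedDictionary μ φ L) (s : Finset ι) :
    Measurable (Function.uncurry fun (z : ι → X) (l : Fin M → ℝ) =>
      ∑ i ∈ s, loss μ φ l (z i)) := by
  refine Finset.measurable_sum _ fun i _ => ?_
  exact D.measurable_loss_comp measurable_snd ((measurable_pi_apply i).comp measurable_fst)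

theorem measurable_sum_loss_left (D : IsBoundedDictionary μ φ L) (s : Finset ι) (z : ι → X) :
    Measurable fun l => ∑ i ∈ s, loss μ φ l (z i) :=
  Finset.measurable_sum _ fun i _ => D.measurable_loss_left (z i)

theorem abs_sum_loss_le (D : IsBoundedDictionary μ φ L) (hL : 0 ≤ L) {l : Fin M → ℝ}
    (hl : ∑ j, |l j| ≤ R) (s : Finset ι) (z : ι → X) :
    |∑ i ∈ s, loss μ φ l (z i)| ≤ s.card * (R ^ 2 + 2 * (R * L)) :=
  calc |∑ i ∈ s, loss μ φ l (z i)| ≤ ∑ i ∈ s, |loss μ φ l (z i)| :=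
        Finset.abs_sum_le_sum_abs _ _
    _ ≤ ∑ _i ∈ s, (R ^ 2 + 2 * (R * L)) :=
        Finset.sum_le_sum fun i _ => D.abs_loss_le hL hl (z i)
    _ = _ := by rw [Finset.sum_const, nsmul_eq_mul]

theorem abs_neg_sum_loss_div_le (D : IsBoundedDictionary μ φ L) (hL : 0 ≤ L) (hβpos : 0 < β)
    {ρ : Measure (Fin M → ℝ)} (hρ : ∀ᵐ l ∂ρ, ∑ j, |l j| ≤ R) (s : Finset ι) (z : ι → X) :
    ∀ᵐ l ∂ρ, |-(∑ i ∈ s, loss μ φ l (z i)) / β| ≤ s.card * (R ^ 2 + 2 * (R * L)) / β := by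
  filter_upwards [hρ] with l hl
  rw [abs_div, abs_neg, abs_of_pos hβpos]
  gcongr
  exact abs_sum_loss_le D hL hl s z

theorem integrable_exp_sum_loss (D : IsBoundedDictionary μ φ L) (hL : 0 ≤ L) (hβpos : 0 < β)
    (hπ : ∀ᵐ l ∂π, ∑ j, |l j| ≤ R) (s : Finset ι) (z : ι → X) :
    Integrable (fun l => Real.exp (-(∑ i ∈ s, loss μ φ l (z i)) / β)) π :=
  integrable_exp_of_abs_le ((measurable_sum_loss_left D s z).neg.div_const β)
    (abs_neg_sum_loss_div_le D hL hβpos hπ s z)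

theorem measurable_posteriorMean (D : IsBoundedDictionary μ φ L) (s : Finset ι) :
    Measurable (posteriorMean μ φ β π s : (ι → X) → Fin M → ℝ) := by
  have h0 : Measurable (Function.uncurry fun (z : ι → X) (l : Fin M → ℝ) =>
      Real.exp (-(∑ i ∈ s, loss μ φ l (z i)) / β)) :=
    Real.measurable_exp.comp ((measurable_sum_loss D s).neg.div_const β)
  rw [measurable_pi_iff]
  intro j
  have e : ∀ z : ι → X, posteriorMean μ φ β π s z j =
      (∫ l, Real.exp (-(∑ i ∈ s, loss μ φ l (z i)) / β) * l j ∂π) /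
        ∫ l, Real.exp (-(∑ i ∈ s, loss μ φ l (z i)) / β) ∂π := fun z => by
    rw [posteriorMean, integral_tilted, ← integral_div]
    congr 1
    ext l
    rw [smul_eq_mul, div_mul_eq_mul_div]
  simp_rw [e]
  have h1 : Measurable (Function.uncurry fun (z : ι → X) (l : Fin M → ℝ) =>
      Real.exp (-(∑ i ∈ s, loss μ φ l (z i)) / β) * l j) :=
    h0.mul ((measurable_pi_apply j).comp measurable_snd)
  exact h1.stronglyMeasurable.integral_prod_right.measurable.div
    h0.stronglyMeasurable.integral_prod_right.measurable

theorem sum_abs_posteriorMean_le (D : IsBoundedDictionary μ φ L) (hL : 0 ≤ L) (hβpos : 0 < β)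
    (hπ : ∀ᵐ l ∂π, ∑ j, |l j| ≤ R) (s : Finset ι) (z : ι → X) :
    ∑ j, |posteriorMean μ φ β π s z j| ≤ R := by
  have : IsProbabilityMeasure (π.tilted fun l => -(∑ i ∈ s, loss μ φ l (z i)) / β) :=
    isProbabilityMeasure_tilted (integrable_exp_sum_loss D hL hβpos hπ s z)
  exact sum_abs_integral_le ((tilted_absolutelyContinuous _ _).ae_le hπ)

theorem integrable_integral_loss_posteriorMean [Fintype ι] (D : IsBoundedDictionary μ φ L) (hL : 0 ≤ L)
    (hβpos : 0 < β) (hπ : ∀ᵐ l ∂π, ∑ j, |l j| ≤ R) (s : Finset ι) :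
    Integrable (fun z : ι → X => ∫ x, loss μ φ (posteriorMean μ φ β π s z) x ∂P)
      (Measure.pi fun _ => P) := by
  have hm : Measurable (Function.uncurry fun (z : ι → X) (x : X) =>
      loss μ φ (posteriorMean μ φ β π s z) x) :=
    D.measurable_loss_comp ((measurable_posteriorMean D s).comp measurable_fst) measurable_snd
  refine integrable_of_abs_le (C := R ^ 2 + 2 * (R * L))
    hm.stronglyMeasurable.integral_prod_right.measurable (Filter.Eventually.of_forall fun z => ?_)
  have hb : ∀ x, ‖loss μ φ (posteriorMean μ φ β π s z) x‖ ≤ R ^ 2 + 2 * (R * L) := fun x =>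
    D.abs_loss_le hL (sum_abs_posteriorMean_le D hL hβpos hπ s z) x
  have := norm_integral_le_of_norm_le_const (μ := P) (Filter.Eventually.of_forall hb)
  simpa using this

theorem integrable_log_partition [Fintype ι] (D : IsBoundedDictionary μ φ L) (hL : 0 ≤ L)
    (hβpos : 0 < β) (hπ : ∀ᵐ l ∂π, ∑ j, |l j| ≤ R) (s : Finset ι) :
    Integrable (fun z : ι → X =>
      Real.log (∫ l, Real.exp (-(∑ i ∈ s, loss μ φ l (z i)) / β) ∂π))
      (Measure.pi fun _ => P) :=
  integrable_of_abs_le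
    (measurable_log_integral_exp ((measurable_sum_loss D s).neg.div_const β))
    (Filter.Eventually.of_forall fun z =>
      abs_log_integral_exp_le ((measurable_sum_loss_left D s z).neg.div_const β)
        (abs_neg_sum_loss_div_le D hL hβpos hπ s z))

theorem integrable_log_partition_add [Fintype ι] (D : IsBoundedDictionary μ φ L) (hL : 0 ≤ L)
    (hβpos : 0 < β) (hπ : ∀ᵐ l ∂π, ∑ j, |l j| ≤ R) (s : Finset ι) :
    Integrable (fun p : (ι → X) × X =>
      Real.log (∫ l, Real.exp (-(∑ i ∈ s, loss μ φ l (p.1 i) + loss μ φ l p.2) / β) ∂π))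
      ((Measure.pi fun _ => P).prod P) := by
  have hm : Measurable (Function.uncurry fun (p : (ι → X) × X) (l : Fin M → ℝ) =>
      -(∑ i ∈ s, loss μ φ l (p.1 i) + loss μ φ l p.2) / β) := by
    refine Measurable.div_const (Measurable.neg (Measurable.add ?_ ?_)) β
    · exact Finset.measurable_sum _ fun i _ => D.measurable_loss_comp measurable_snd
        ((measurable_pi_apply i).comp (measurable_fst.comp measurable_fst))
    · exact D.measurable_loss_comp measurable_snd (measurable_snd.comp measurable_fst)
  refine integrable_of_abs_le (C := (s.card * (R ^ 2 + 2 * (R * L)) + (R ^ 2 + 2 * (R * L))) / β)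
    (measurable_log_integral_exp hm)
    (Filter.Eventually.of_forall fun p => abs_log_integral_exp_le
      (((measurable_sum_loss_left D s p.1).add (D.measurable_loss_left p.2)).neg.div_const β) ?_)
  filter_upwards [hπ] with l hl
  rw [abs_div, abs_neg, abs_of_pos hβpos]
  gcongr
  exact (abs_add_le _ _).trans (add_le_add (abs_sum_loss_le D hL hl s p.1)
    (D.abs_loss_le hL hl p.2))

theorem integral_log_partition_insert [Fintype ι] [DecidableEq ι] (D : IsBoundedDictionary μ φ L) (hL : 0 ≤ L)
    (hβpos : 0 < β) (hπ : ∀ᵐ l ∂π, ∑ j, |l j| ≤ R) {s : Finset ι} {i : ι} (hi : i ∉ s) :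
    ∫ z : ι → X, ∫ x, Real.log (∫ l, Real.exp (-(∑ i ∈ s, loss μ φ l (z i) + loss μ φ l x) / β) ∂π)
        ∂P ∂(Measure.pi fun _ => P) =
      ∫ z : ι → X, Real.log (∫ l, Real.exp (-(∑ i ∈ insert i s, loss μ φ l (z i)) / β) ∂π)
        ∂(Measure.pi fun _ => P) := by
  have hmp := measurePreserving_update P i
  rw [← integral_prod _ (integrable_log_partition_add D hL hβpos hπ s)]
  have hmeas := (integrable_log_partition (P := P) D hL hβpos hπ (insert i s)).1
  rw [← hmp.map_eq] at hmeas
  conv_rhs => rw [← hmp.map_eq]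
  rw [integral_map hmp.measurable.aemeasurable hmeas]
  congr 1
  ext p
  congr 2
  ext l
  congr 2
  rw [Finset.sum_insert hi, Function.update_self, add_comm]
  congr 2
  exact Finset.sum_congr rfl fun k hk => by
    rw [Function.update_of_ne (show k ≠ i by rintro rfl; exact hi hk)]

end Sample

/-- The cumulative risk of the posterior means is bounded by the expected log-partition
function. -/
theorem sum_integral_loss_posteriorMean_le {X : Type*} [MeasurableSpace X] {n M : ℕ}
    {μ P : Measure X} [IsProbabilityMeasure P] {φ : Fin M → X → ℝ} {f : X → ℝ} {L R β : ℝ}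
    {π : Measure (Fin M → ℝ)} [IsProbabilityMeasure π]
    (D : IsBoundedDictionary μ φ L) (F : IsBoundedDensity μ P f L)
    (hL : 0 ≤ L) (hR : 0 ≤ R) (hβpos : 0 < β)
    (hβ : 2 * L + 4 * R * L ≤
      (β - 2 * R ^ 2) * Real.exp (-(4 * R * (L + Real.sqrt L)) / β))
    (hπ : ∀ᵐ l ∂π, ∑ j, |l j| ≤ R) :
    ∑ m ∈ Finset.range (n + 1), ∫ z : Fin n → X, ∫ x, loss μ φ
        (posteriorMean μ φ β π (Finset.univ.filter fun i : Fin n => (i : ℕ) < m) z) x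
        ∂P ∂(Measure.pi fun _ => P) ≤
      -β * ∫ z : Fin n → X, ∫ x, Real.log
        (∫ l, Real.exp (-(∑ i, loss μ φ l (z i) + loss μ φ l x) / β) ∂π)
        ∂P ∂(Measure.pi fun _ => P) := by
  set A : ℕ → Finset (Fin n) := fun m => Finset.univ.filter fun i : Fin n => (i : ℕ) < m with hA
  set Φ : ℕ → ℝ := fun m => ∫ z : Fin n → X,
    Real.log (∫ l, Real.exp (-(∑ i ∈ A m, loss μ φ l (z i)) / β) ∂π) ∂(Measure.pi fun _ => P)
    with hΦ
  set Ψ : ℕ → ℝ := fun m => ∫ z : Fin n → X, ∫ x,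
    Real.log (∫ l, Real.exp (-(∑ i ∈ A m, loss μ φ l (z i) + loss μ φ l x) / β) ∂π)
    ∂P ∂(Measure.pi fun _ => P) with hΨ
  have hstep : ∀ m, ∫ z : Fin n → X, ∫ x, loss μ φ (posteriorMean μ φ β π (A m) z) x
      ∂P ∂(Measure.pi fun _ => P) ≤ -β * (Ψ m - Φ m) := fun m => by
    have i1 := (integrable_log_partition_add (P := P) D hL hβpos hπ (A m)).integral_prod_left
    have i2 := integrable_log_partition (P := P) D hL hβpos hπ (A m)
    rw [hΨ, hΦ]
    simp only
    rw [← integral_sub i1 i2, ← integral_const_mul]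
    refine integral_mono (integrable_integral_loss_posteriorMean D hL hβpos hπ (A m))
      ((i1.sub i2).const_mul _) fun z => ?_
    refine integral_loss_tilted_le D F hL hR hβpos hβ hπ (measurable_sum_loss_left D (A m) z)
      (C := (A m).card * (R ^ 2 + 2 * (R * L))) ?_
    filter_upwards [hπ] with l hl
    exact abs_sum_loss_le D hL hl (A m) z
  have hnext : ∀ m, m < n → Ψ m = Φ (m + 1) := fun m hm => by
    have hins : A (m + 1) = insert ⟨m, hm⟩ (A m) := by
      ext i
      simp only [hA, Finset.mem_filter, Finset.mem_univ, true_and, Finset.mem_insert, Fin.ext_iff]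
      omega
    rw [hΦ]
    simp only
    rw [hins]
    exact integral_log_partition_insert D hL hβpos hπ (by simp [hA])
  have h0 : Φ 0 = 0 := by simp [hΦ, hA]
  have hn : A n = Finset.univ := by simp [hA]
  have hsum : ∑ m ∈ Finset.range (n + 1), -β * (Ψ m - Φ m) = -β * Ψ n := by
    rw [← Finset.mul_sum, Finset.sum_range_succ, Finset.sum_congr rfl fun m hm => by
      rw [hnext m (Finset.mem_range.1 hm)], Finset.sum_range_sub, h0]
    ring
  calc _ ≤ ∑ m ∈ Finset.range (n + 1), -β * (Ψ m - Φ m) := Finset.sum_le_sum fun m _ => hstep m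
    _ = -β * Ψ n := hsum
    _ = _ := by simp only [hΨ, hn]

/-- The change-of-measure bound for a log-partition function. -/
theorem neg_log_integral_exp_neg_le {E : Type*} [MeasurableSpace E] {π p : Measure E}
    [IsProbabilityMeasure π] [IsProbabilityMeasure p] {K C : ℝ} (hK : 0 < K)
    (hp : p ≤ ENNReal.ofReal K • π) {S : E → ℝ} (hS : Measurable S) (hSC : ∀ᵐ l ∂π, |S l| ≤ C) :
    -Real.log (∫ l, Real.exp (-S l) ∂π) ≤ Real.log K + ∫ l, S l ∂p := by
  have hac : p ≪ π := (Measure.absolutelyContinuous_of_le hp).trans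
    (Measure.smul_absolutelyContinuous)
  have hπC : ∀ᵐ l ∂π, |-S l| ≤ C := by simpa using hSC
  have iπ := integrable_exp_of_abs_le hS.neg hπC
  have ip := integrable_exp_of_abs_le hS.neg (hac.ae_le hπC)
  have iS : Integrable (fun l => -S l) p := integrable_of_abs_le hS.neg (hac.ae_le hπC)
  have h1 := exp_integral_le_integral_exp iS ip
  have h2 : ∫ l, Real.exp (-S l) ∂p ≤ K * ∫ l, Real.exp (-S l) ∂π := by
    calc ∫ l, Real.exp (-S l) ∂p ≤ ∫ l, Real.exp (-S l) ∂(ENNReal.ofReal K • π) :=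
          integral_mono_measure hp (Filter.Eventually.of_forall fun _ => (Real.exp_pos _).le)
            (iπ.smul_measure ENNReal.ofReal_ne_top)
      _ = _ := by rw [integral_smul_measure, ENNReal.toReal_ofReal hK.le, smul_eq_mul]
  have h3 : 0 < ∫ l, Real.exp (-S l) ∂π := integral_exp_pos iπ
  have h4 := Real.log_le_log (Real.exp_pos _) (h1.trans h2)
  rw [Real.log_exp, Real.log_mul hK.ne' h3.ne', integral_neg] at h4
  linarith

/-- A probability measure centred at `a`, with uncorrelated coordinates of variance at most `v`,
dominated by `K • π`. -/
structure IsCentredAt {M : ℕ} (π p : Measure (Fin M → ℝ)) (K v : ℝ) (a : Fin M → ℝ) : Prop where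
  isProbabilityMeasure : IsProbabilityMeasure p
  le_smul : p ≤ ENNReal.ofReal K • π
  integral_eq : ∀ j, ∫ l, l j ∂p = a j
  integral_mul_eq_zero : ∀ i j, i ≠ j → ∫ l, (l i - a i) * (l j - a j) ∂p = 0
  integral_sq_le : ∀ j, ∫ l, (l j - a j) ^ 2 ∂p ≤ v

namespace IsCentredAt

variable {X : Type*} [MeasurableSpace X] {M : ℕ} {μ P : Measure X} {φ : Fin M → X → ℝ}
  {L R K v : ℝ} {π p : Measure (Fin M → ℝ)} {a : Fin M → ℝ}

theorem absolutelyContinuous (H : IsCentredAt π p K v a) : p ≪ π :=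
  (Measure.absolutelyContinuous_of_le H.le_smul).trans Measure.smul_absolutelyContinuous

theorem integral_energy_le (H : IsCentredAt π p K v a) (D : IsBoundedDictionary μ φ L)
    (hπ : ∀ᵐ l ∂π, ∑ j, |l j| ≤ R) :
    ∫ l, energy μ φ l ∂p ≤ energy μ φ a + M * v := by
  have := H.isProbabilityMeasure
  have hp : ∀ᵐ l ∂p, ∑ j, |l j| ≤ R := H.absolutelyContinuous.ae_le hπ
  have ic := integrable_coord hp
  have bc : ∀ j, ∀ᵐ l ∂p, |l j| ≤ R := fun j => by
    filter_upwards [hp] with l hl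
    exact (Finset.single_le_sum (f := fun j => |l j|) (fun _ _ => abs_nonneg _)
      (Finset.mem_univ j)).trans hl
  have icc : ∀ i j, Integrable (fun l : Fin M → ℝ => l i * l j) p := fun i j => by
    refine integrable_of_abs_le (C := R * R)
      ((measurable_pi_apply i).mul (measurable_pi_apply j)) ?_
    filter_upwards [bc i, bc j] with l hi hj
    rw [abs_mul]
    exact mul_le_mul hi hj (abs_nonneg _) ((abs_nonneg _).trans hi)
  have cov : ∀ i j, ∫ l, l i * l j ∂p = a i * a j + ∫ l, (l i - a i) * (l j - a j) ∂p :=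
    fun i j => by
      have e : ∀ l : Fin M → ℝ, (l i - a i) * (l j - a j) =
          l i * l j - a j * l i - a i * l j + a i * a j := fun l => by ring
      have i1 : Integrable (fun l : Fin M → ℝ => l i * l j - a j * l i) p :=
        (icc i j).sub ((ic i).const_mul (a j))
      have i2 : Integrable (fun l : Fin M → ℝ => l i * l j - a j * l i - a i * l j) p :=
        i1.sub ((ic j).const_mul (a i))
      simp_rw [e]
      rw [integral_add i2 (integrable_const _), integral_sub i1 ((ic j).const_mul (a i)),
        integral_sub (icc i j) ((ic i).const_mul (a j)), integral_const_mul, integral_const_mul,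
        H.integral_eq, H.integral_eq]
      simp
      ring
  have e1 : ∫ l, energy μ φ l ∂p = ∑ i, ∑ j, (∫ l, l i * l j ∂p) * ∫ x, φ i x * φ j x ∂μ := by
    simp_rw [D.energy_eq_sum]
    rw [integral_finsetSum _ fun i _ => integrable_finsetSum _ fun j _ => (icc i j).mul_const _]
    refine Finset.sum_congr rfl fun i _ => ?_
    rw [integral_finsetSum _ fun j _ => (icc i j).mul_const _]
    exact Finset.sum_congr rfl fun j _ => integral_mul_const _ _
  have e2 : ∀ i, ∑ j, (∫ l, l i * l j ∂p) * ∫ x, φ i x * φ j x ∂μ ≤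
      (∑ j, a i * a j * ∫ x, φ i x * φ j x ∂μ) + v := fun i => by
    simp_rw [cov i, add_mul]
    rw [Finset.sum_add_distrib]
    gcongr
    rw [Finset.sum_eq_single i]
    · have : ∫ x, φ i x * φ i x ∂μ = 1 := by simpa only [sq] using D.integral_sq i
      rw [this, mul_one]
      simpa only [sq] using H.integral_sq_le i
    · intro j _ hj
      rw [H.integral_mul_eq_zero i j hj.symm, zero_mul]
    · simp
  rw [e1, D.energy_eq_sum]
  refine (Finset.sum_le_sum fun i _ => e2 i).trans (le_of_eq ?_)
  simp [Finset.sum_add_distrib]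

theorem integral_loss_le (H : IsCentredAt π p K v a) (D : IsBoundedDictionary μ φ L)
    (hπ : ∀ᵐ l ∂π, ∑ j, |l j| ≤ R) (x : X) :
    ∫ l, loss μ φ l x ∂p ≤ loss μ φ a x + M * v := by
  have := H.isProbabilityMeasure
  have hp : ∀ᵐ l ∂p, ∑ j, |l j| ≤ R := H.absolutelyContinuous.ae_le hπ
  have ie : Integrable (energy μ φ) p := by
    refine integrable_of_abs_le (C := R ^ 2) D.measurable_energy ?_
    filter_upwards [hp] with l hl
    rw [abs_of_nonneg (IsBoundedDictionary.energy_nonneg l)]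
    exact D.energy_le hl
  have il : ∀ j, Integrable (fun l : Fin M → ℝ => l j * φ j x) p := fun j =>
    (integrable_coord hp j).mul_const _
  have i_lin : Integrable (fun l => lincomb φ l x) p := integrable_finsetSum _ fun j _ => il j
  have e : ∫ l, lincomb φ l x ∂p = lincomb φ a x := by
    simp only [lincomb]
    rw [integral_finsetSum _ fun j _ => il j]
    simp_rw [integral_mul_const, H.integral_eq]
  have := H.integral_energy_le D hπ
  unfold loss
  rw [integral_sub ie (i_lin.const_mul 2), integral_const_mul, e]
  linarith

theorem integral_log_partition_le (H : IsCentredAt π p K v a) [IsProbabilityMeasure P]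
    [IsProbabilityMeasure π] {ι : Type*} [Fintype ι] {β : ℝ}
    (D : IsBoundedDictionary μ φ L) (hL : 0 ≤ L) (hβpos : 0 < β) (hK : 0 < K)
    (hπ : ∀ᵐ l ∂π, ∑ j, |l j| ≤ R) (ha : ∑ j, |a j| ≤ R) :
    -β * ∫ z : ι → X, ∫ x, Real.log
        (∫ l, Real.exp (-(∑ i, loss μ φ l (z i) + loss μ φ l x) / β) ∂π)
        ∂P ∂(Measure.pi fun _ => P) ≤
      β * Real.log K + (Fintype.card ι + 1) * ((∫ x, loss μ φ a x ∂P) + M * v) := by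
  have := H.isProbabilityMeasure
  have hp : ∀ᵐ l ∂p, ∑ j, |l j| ≤ R := H.absolutelyContinuous.ae_le hπ
  have ip : ∀ x, Integrable (fun l => loss μ φ l x) p := fun x => by
    refine integrable_of_abs_le (D.measurable_loss_left x) (C := R ^ 2 + 2 * (R * L)) ?_
    filter_upwards [hp] with l hl
    exact D.abs_loss_le hL hl x
  have key : ∀ (z : ι → X) (x : X), -β * Real.log
      (∫ l, Real.exp (-(∑ i, loss μ φ l (z i) + loss μ φ l x) / β) ∂π) ≤
      β * Real.log K + (∑ i, (loss μ φ a (z i) + M * v) + (loss μ φ a x + M * v)) := fun z x => by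
    have h1 := neg_log_integral_exp_neg_le hK H.le_smul
      (S := fun l => (∑ i, loss μ φ l (z i) + loss μ φ l x) / β)
      (C := ((Finset.univ : Finset ι).card * (R ^ 2 + 2 * (R * L)) + (R ^ 2 + 2 * (R * L))) / β)
      (((measurable_sum_loss_left D _ z).add (D.measurable_loss_left x)).div_const β) (by
        filter_upwards [hπ] with l hl
        rw [abs_div, abs_of_pos hβpos]
        gcongr
        exact (abs_add_le _ _).trans (add_le_add (abs_sum_loss_le D hL hl _ z)
          (D.abs_loss_le hL hl x)))
    simp_rw [← neg_div] at h1
    rw [integral_div, integral_add (integrable_finsetSum _ fun i _ => ip (z i)) (ip x),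
      integral_finsetSum _ fun i _ => ip (z i)] at h1
    have h2 : ∑ i, ∫ l, loss μ φ l (z i) ∂p + ∫ l, loss μ φ l x ∂p ≤
        ∑ i, (loss μ φ a (z i) + M * v) + (loss μ φ a x + M * v) :=
      add_le_add (Finset.sum_le_sum fun i _ => H.integral_loss_le D hπ (z i))
        (H.integral_loss_le D hπ x)
    have h3 := mul_le_mul_of_nonneg_left h1 hβpos.le
    rw [mul_add, mul_div_cancel₀ _ hβpos.ne'] at h3
    linarith
  have i_loss : Integrable (loss μ φ a) P := integrable_of_abs_le (D.measurable_loss_right a)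
    (Filter.Eventually.of_forall fun x => D.abs_loss_le hL ha x)
  have i_x : Integrable (fun x => loss μ φ a x + M * v) P := i_loss.add (integrable_const _)
  have i_z : ∀ i : ι, Integrable (fun z : ι → X => loss μ φ a (z i) + M * v)
      (Measure.pi fun _ => P) := fun i =>
    (measurePreserving_eval (fun _ : ι => P) i).integrable_comp_of_integrable i_x
  have e_z : ∀ i : ι, ∫ z : ι → X, (loss μ φ a (z i) + M * v) ∂(Measure.pi fun _ => P) =
      ∫ x, (loss μ φ a x + M * v) ∂P := fun i =>
    integral_comp_eval (μ := fun _ : ι => P) (i := i) i_x.aestronglyMeasurable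
  have e_x : ∫ x, (loss μ φ a x + M * v) ∂P = (∫ x, loss μ φ a x ∂P) + M * v := by
    rw [integral_add i_loss (integrable_const _)]; simp
  have ilp := integrable_log_partition_add (P := P) D hL hβpos hπ (Finset.univ : Finset ι)
  have i_sum : Integrable (fun z : ι → X => ∑ i, (loss μ φ a (z i) + M * v))
      (Measure.pi fun _ => P) := integrable_finsetSum _ fun i _ => i_z i
  have i_pt : Integrable (fun q : (ι → X) × X =>
      ∑ i, (loss μ φ a (q.1 i) + M * v) + (loss μ φ a q.2 + M * v))
      ((Measure.pi fun _ => P).prod P) := (i_sum.comp_fst P).add (i_x.comp_snd _)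
  have i_rhs : Integrable (fun q : (ι → X) × X => β * Real.log K +
      (∑ i, (loss μ φ a (q.1 i) + M * v) + (loss μ φ a q.2 + M * v)))
      ((Measure.pi fun _ => P).prod P) :=
    (integrable_const _).add i_pt
  rw [← integral_prod _ ilp, ← integral_const_mul]
  refine (integral_mono (ilp.const_mul _) i_rhs fun q => key q.1 q.2).trans (le_of_eq ?_)
  rw [integral_add (integrable_const _) i_pt, integral_add (i_sum.comp_fst P) (i_x.comp_snd _),
    integral_fun_fst (fun z : ι → X => ∑ i, (loss μ φ a (z i) + M * v)),
    integral_fun_snd (fun x => loss μ φ a x + M * v), integral_finsetSum _ fun i _ => i_z i]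
  simp_rw [e_z, e_x]
  simp
  ring

end IsCentredAt

/-- The unnormalized one-dimensional density `(τ² + x²)⁻²` of the sparsity prior. -/
noncomputable def heavyTail (τ x : ℝ) : ℝ := ((τ ^ 2 + x ^ 2) ^ 2)⁻¹

section HeavyTail

variable {τ : ℝ}

theorem sq_add_sq_pos_of_pos (hτ : 0 < τ) (x : ℝ) : 0 < τ ^ 2 + x ^ 2 := by positivity

theorem heavyTail_pos (hτ : 0 < τ) (x : ℝ) : 0 < heavyTail τ x := by
  unfold heavyTail
  positivity

theorem heavyTail_neg (τ x : ℝ) : heavyTail τ (-x) = heavyTail τ x := by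
  simp [heavyTail]

theorem continuous_heavyTail (hτ : 0 < τ) : Continuous (heavyTail τ) :=
  Continuous.inv₀ (by fun_prop) fun x => (pow_pos (sq_add_sq_pos_of_pos hτ x) 2).ne'

theorem integrable_inv_sq_add_sq (hτ : 0 < τ) :
    Integrable fun x : ℝ => (τ ^ 2 + x ^ 2)⁻¹ := by
  have h := (integrable_inv_one_add_sq.comp_div hτ.ne').const_mul (τ ^ 2)⁻¹
  refine h.congr (Filter.Eventually.of_forall fun x => ?_)
  have := (sq_add_sq_pos_of_pos hτ x).ne'
  simp only
  rw [← mul_inv]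
  congr 1
  field_simp

theorem sq_mul_heavyTail (hτ : 0 < τ) (x : ℝ) :
    x ^ 2 * heavyTail τ x = (τ ^ 2 + x ^ 2)⁻¹ - τ ^ 2 * heavyTail τ x := by
  have := (sq_add_sq_pos_of_pos hτ x).ne'
  unfold heavyTail
  field_simp
  ring

theorem integrable_heavyTail (hτ : 0 < τ) : Integrable (heavyTail τ) := by
  refine ((integrable_inv_sq_add_sq hτ).const_mul (τ ^ 2)⁻¹).mono'
    (continuous_heavyTail hτ).aestronglyMeasurable (Filter.Eventually.of_forall fun x => ?_)
  rw [Real.norm_of_nonneg (heavyTail_pos hτ x).le, heavyTail, sq (τ ^ 2 + x ^ 2), mul_inv]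
  have := sq_add_sq_pos_of_pos hτ x
  gcongr
  nlinarith [sq_nonneg x]

theorem integrable_sq_mul_heavyTail (hτ : 0 < τ) :
    Integrable fun x : ℝ => x ^ 2 * heavyTail τ x := by
  simp_rw [sq_mul_heavyTail hτ]
  exact (integrable_inv_sq_add_sq hτ).sub ((integrable_heavyTail hτ).const_mul _)

theorem hasDerivAt_div_sq_add_sq (hτ : 0 < τ) (x : ℝ) :
    HasDerivAt (fun x : ℝ => x / (τ ^ 2 + x ^ 2))
      (τ ^ 2 * heavyTail τ x - x ^ 2 * heavyTail τ x) x := by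
  have hne := (sq_add_sq_pos_of_pos hτ x).ne'
  have h1 : HasDerivAt (fun x : ℝ => τ ^ 2 + x ^ 2) (2 * x) x := by
    simpa using (hasDerivAt_pow 2 x).const_add (τ ^ 2)
  refine ((hasDerivAt_id' x).div h1 hne).congr_deriv ?_
  unfold heavyTail
  field_simp
  ring

theorem tendsto_div_sq_add_sq {l : Filter ℝ} (hl : Filter.Tendsto (fun x : ℝ => x⁻¹) l (nhds 0)) :
    Filter.Tendsto (fun x : ℝ => x / (τ ^ 2 + x ^ 2)) l (nhds 0) := by
  refine squeeze_zero_norm (fun x => ?_) (by simpa using hl.abs)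
  rw [Real.norm_eq_abs, abs_div, abs_of_nonneg (by positivity : 0 ≤ τ ^ 2 + x ^ 2)]
  rcases eq_or_ne x 0 with rfl | hx
  · simp
  · have : 0 < |x| := abs_pos.2 hx
    rw [div_le_iff₀ (by positivity), inv_mul_eq_div, le_div_iff₀ this, ← sq, sq_abs]
    nlinarith [sq_nonneg τ]

theorem integral_sq_mul_heavyTail (hτ : 0 < τ) :
    ∫ x, x ^ 2 * heavyTail τ x = τ ^ 2 * ∫ x, heavyTail τ x := by
  have i1 := (integrable_heavyTail hτ).const_mul (τ ^ 2)
  have i2 := integrable_sq_mul_heavyTail hτ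
  have h := integral_of_hasDerivAt_of_tendsto (hasDerivAt_div_sq_add_sq hτ) (i1.sub i2)
    (tendsto_div_sq_add_sq tendsto_inv_atBot_zero) (tendsto_div_sq_add_sq tendsto_inv_atTop_zero)
  rw [integral_sub i1 i2, integral_const_mul] at h
  linarith

theorem heavyTail_le_mul_heavyTail_add (hτ : 0 < τ) (x a : ℝ) :
    heavyTail τ x ≤ (1 + τ⁻¹ * |a|) ^ 4 * heavyTail τ (x + a) := by
  have h1 : τ ^ 2 + (x + a) ^ 2 ≤ (τ ^ 2 + x ^ 2) * (1 + τ⁻¹ * |a|) ^ 2 := by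
    set b := τ⁻¹ * |a| with hb
    have hb0 : 0 ≤ b := by positivity
    have hab : |a| = τ * b := by rw [hb]; field_simp
    have h2 : (x + a) ^ 2 ≤ (|x| + τ * b) ^ 2 := by
      rw [← hab, ← sq_abs (x + a)]
      gcongr
      exact abs_add_le x a
    have h3 := sq_abs x
    nlinarith [sq_nonneg (|x| - τ), mul_nonneg hb0 (sq_nonneg (|x| - τ)),
      mul_nonneg (mul_nonneg hb0 hb0) (sq_nonneg x)]
  have p1 := sq_add_sq_pos_of_pos hτ x
  have p2 := sq_add_sq_pos_of_pos hτ (x + a)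
  unfold heavyTail
  rw [← div_eq_mul_inv, le_div_iff₀ (by positivity), inv_mul_le_iff₀ (by positivity)]
  calc (τ ^ 2 + (x + a) ^ 2) ^ 2 ≤ ((τ ^ 2 + x ^ 2) * (1 + τ⁻¹ * |a|) ^ 2) ^ 2 := by gcongr
    _ = _ := by ring

end HeavyTail

/-- The product of the measures with densities `g` has the product density. -/
theorem pi_withDensity_ofReal {ι : Type*} [Fintype ι] {g : ℝ → ℝ} (hg : Integrable g)
    (h0 : ∀ x, 0 ≤ g x) :
    Measure.pi (fun _ : ι => volume.withDensity fun x => ENNReal.ofReal (g x)) =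
      volume.withDensity fun l : ι → ℝ => ENNReal.ofReal (∏ j, g (l j)) := by
  have hfin : IsFiniteMeasure (volume.withDensity fun x => ENNReal.ofReal (g x)) :=
    isFiniteMeasure_withDensity_ofReal hg.2
  refine Measure.pi_eq fun s hs => ?_
  rw [withDensity_apply _ (MeasurableSet.univ_pi hs), volume_pi, Measure.restrict_pi_pi]
  have hi : ∀ j, Integrable g (volume.restrict (s j)) := fun j => hg.restrict
  rw [← ofReal_integral_eq_lintegral_ofReal (Integrable.fintype_prod_dep hi)
    (Filter.Eventually.of_forall fun l => Finset.prod_nonneg fun j _ => h0 _),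
    integral_fintype_prod_eq_prod,
    ENNReal.ofReal_prod_of_nonneg fun j _ => integral_nonneg fun x => h0 x]
  refine Finset.prod_congr rfl fun j _ => ?_
  rw [withDensity_apply _ (hs j), ofReal_integral_eq_lintegral_ofReal (hi j)
    (Filter.Eventually.of_forall h0)]

section TruncatedProduct

variable {M : ℕ} {ν : Measure ℝ} {τ : ℝ}

/-- Negation of the `i`-th coordinate. -/
def flipCoord {M : ℕ} (i : Fin M) (l : Fin M → ℝ) : Fin M → ℝ :=
  fun j => (if j = i then fun x : ℝ => -x else id) (l j)

theorem flipCoord_self (i : Fin M) (l : Fin M → ℝ) : flipCoord i l i = -l i := by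
  simp [flipCoord]

theorem flipCoord_of_ne {i j : Fin M} (h : j ≠ i) (l : Fin M → ℝ) : flipCoord i l j = l j := by
  simp [flipCoord, h]

theorem abs_flipCoord (i j : Fin M) (l : Fin M → ℝ) : |flipCoord i l j| = |l j| := by
  by_cases h : j = i
  · subst h
    rw [flipCoord_self, abs_neg]
  · rw [flipCoord_of_ne h]

theorem measurePreserving_flipCoord [IsProbabilityMeasure ν]
    (hν : MeasurePreserving (fun x : ℝ => -x) ν ν) (i : Fin M) :
    MeasurePreserving (flipCoord i) (Measure.pi fun _ => ν) (Measure.pi fun _ => ν) := by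
  refine measurePreserving_pi (fun _ => ν) (fun _ => ν) fun j => ?_
  by_cases h : j = i
  · simpa [h] using hν
  · simpa [h] using MeasurePreserving.id ν

/-- The `ℓ¹` ball of radius `r`. -/
def l1Ball (M : ℕ) (r : ℝ) : Set (Fin M → ℝ) := {l | ∑ j, |l j| ≤ r}

theorem measurableSet_l1Ball (M : ℕ) (r : ℝ) : MeasurableSet (l1Ball M r) :=
  measurableSet_le (by fun_prop) measurable_const

theorem integral_cond_l1Ball {ρ : Measure (Fin M → ℝ)} (r : ℝ) (F : (Fin M → ℝ) → ℝ) :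
    ∫ l, F l ∂ρ[|l1Ball M r] = (ρ.real (l1Ball M r))⁻¹ * ∫ l in l1Ball M r, F l ∂ρ := by
  rw [ProbabilityTheory.cond, integral_smul_measure, ENNReal.toReal_inv, smul_eq_mul]
  rfl

theorem integral_cond_l1Ball_eq_zero [IsProbabilityMeasure ν]
    (hν : MeasurePreserving (fun x : ℝ => -x) ν ν) (r : ℝ) (i : Fin M) {F : (Fin M → ℝ) → ℝ}
    (hF : Measurable F) (hodd : ∀ l, F (flipCoord i l) = -F l) :
    ∫ l, F l ∂(Measure.pi fun _ => ν)[|l1Ball M r] = 0 := by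
  have hmp := measurePreserving_flipCoord hν i
  rw [integral_cond_l1Ball, ← integral_indicator (measurableSet_l1Ball M r)]
  have h : ∫ l, (l1Ball M r).indicator F l ∂(Measure.pi fun _ => ν) =
      -∫ l, (l1Ball M r).indicator F l ∂(Measure.pi fun _ => ν) := by
    conv_lhs => rw [← hmp.map_eq]
    rw [integral_map hmp.measurable.aemeasurable
      (hF.indicator (measurableSet_l1Ball M r)).aestronglyMeasurable, ← integral_neg]
    congr 1
    ext l
    have hmem : flipCoord i l ∈ l1Ball M r ↔ l ∈ l1Ball M r := by
      simp [l1Ball, abs_flipCoord]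
    by_cases hl : l ∈ l1Ball M r
    · rw [Set.indicator_of_mem hl, Set.indicator_of_mem (hmem.2 hl), hodd]
    · rw [Set.indicator_of_notMem hl, Set.indicator_of_notMem (mt hmem.1 hl), neg_zero]
  rw [show ∫ l, (l1Ball M r).indicator F l ∂(Measure.pi fun _ => ν) = 0 by linarith, mul_zero]

theorem half_le_pi_l1Ball [IsProbabilityMeasure ν] (hτ : 0 < τ) (hM : 0 < M)
    (hi : Integrable (fun x : ℝ => x ^ 2) ν) (h2 : ∫ x, x ^ 2 ∂ν ≤ τ ^ 2) :
    1 / 2 ≤ (Measure.pi fun _ : Fin M => ν).real (l1Ball M (2 * M * τ)) := by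
  have hb : ∀ x : ℝ, |x| ≤ (τ ^ 2 + x ^ 2) / (2 * τ) := fun x => by
    rw [le_div_iff₀ (by positivity)]
    nlinarith [sq_nonneg (|x| - τ), sq_abs x]
  have ib : Integrable (fun x : ℝ => (τ ^ 2 + x ^ 2) / (2 * τ)) ν :=
    ((integrable_const _).add hi).div_const _
  have i1 : Integrable (fun x : ℝ => |x|) ν :=
    ib.mono' (by fun_prop) (Filter.Eventually.of_forall fun x => by
      rw [Real.norm_eq_abs, abs_abs]
      exact hb x)
  have h1 : ∫ x, |x| ∂ν ≤ τ := by
    refine (integral_mono i1 ib hb).trans ?_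
    rw [integral_div, integral_add (integrable_const _) hi, div_le_iff₀ (by positivity)]
    simp
    nlinarith
  have ij : ∀ j : Fin M, Integrable (fun l : Fin M → ℝ => |l j|) (Measure.pi fun _ => ν) :=
    fun j => integrable_comp_eval (μ := fun _ : Fin M => ν) (i := j) i1
  have hsum : ∫ l : Fin M → ℝ, ∑ j, |l j| ∂(Measure.pi fun _ => ν) ≤ M * τ := by
    rw [integral_finsetSum _ fun j _ => ij j]
    calc ∑ j : Fin M, ∫ l : Fin M → ℝ, |l j| ∂(Measure.pi fun _ => ν)
        = ∑ _j : Fin M, ∫ x, |x| ∂ν := Finset.sum_congr rfl fun j _ =>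
          integral_comp_eval (μ := fun _ : Fin M => ν) (i := j) i1.aestronglyMeasurable
      _ ≤ ∑ _j : Fin M, τ := Finset.sum_le_sum fun _ _ => h1
      _ = M * τ := by simp
  have hmarkov := mul_meas_ge_le_integral_of_nonneg (μ := Measure.pi fun _ : Fin M => ν)
    (f := fun l : Fin M → ℝ => ∑ j, |l j|)
    (Filter.Eventually.of_forall fun l => Finset.sum_nonneg fun _ _ => abs_nonneg _)
    (integrable_finsetSum _ fun j _ => ij j) (2 * M * τ)
  have hcompl : (Measure.pi fun _ : Fin M => ν).real (l1Ball M (2 * M * τ))ᶜ ≤ 1 / 2 := by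
    have hsub : (l1Ball M (2 * M * τ))ᶜ ⊆ {l : Fin M → ℝ | 2 * M * τ ≤ ∑ j, |l j|} :=
      fun l hl => (not_le.1 (show ¬∑ j, |l j| ≤ 2 * M * τ from hl)).le
    refine (measureReal_mono hsub).trans ?_
    have hMτ : 0 < (M : ℝ) * τ := mul_pos (Nat.cast_pos.2 hM) hτ
    have := hmarkov.trans hsum
    by_contra! hlt
    nlinarith
  have := probReal_compl_eq_one_sub (μ := Measure.pi fun _ : Fin M => ν)
    (measurableSet_l1Ball M (2 * M * τ))
  linarith

theorem integral_cond_l1Ball_sq_le [IsProbabilityMeasure ν] (hτ : 0 < τ) (hM : 0 < M)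
    (hi : Integrable (fun x : ℝ => x ^ 2) ν) (h2 : ∫ x, x ^ 2 ∂ν ≤ τ ^ 2) (j : Fin M) :
    ∫ l, l j ^ 2 ∂(Measure.pi fun _ => ν)[|l1Ball M (2 * M * τ)] ≤ 2 * τ ^ 2 := by
  have hhalf := half_le_pi_l1Ball hτ hM hi h2
  have h3 : ∫ l in l1Ball M (2 * M * τ), l j ^ 2 ∂(Measure.pi fun _ => ν) ≤ τ ^ 2 := by
    refine (setIntegral_le_integral
      (integrable_comp_eval (μ := fun _ : Fin M => ν) (i := j) hi)
      (Filter.Eventually.of_forall fun l => sq_nonneg (l j))).trans ?_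
    rwa [integral_comp_eval (μ := fun _ : Fin M => ν) (i := j) (f := fun x : ℝ => x ^ 2)
      hi.aestronglyMeasurable]
  rw [integral_cond_l1Ball]
  have h4 : ((Measure.pi fun _ : Fin M => ν).real (l1Ball M (2 * M * τ)))⁻¹ ≤ 2 := by
    rw [inv_le_comm₀ (by linarith) two_pos]
    linarith
  have h5 : 0 ≤ ∫ l in l1Ball M (2 * M * τ), l j ^ 2 ∂(Measure.pi fun _ => ν) :=
    integral_nonneg fun l => sq_nonneg (l j)
  exact mul_le_mul h4 h3 h5 two_pos.le

/-- The translate by `a` of a symmetric product measure truncated to an `ℓ¹` ball is centred at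
`a`, provided it is dominated by the prior. -/
theorem isCentredAt_map_cond [IsProbabilityMeasure ν]
    (hν : MeasurePreserving (fun x : ℝ => -x) ν ν) (hτ : 0 < τ) (hM : 0 < M)
    (hi : Integrable (fun x : ℝ => x ^ 2) ν) (h2 : ∫ x, x ^ 2 ∂ν ≤ τ ^ 2)
    {π : Measure (Fin M → ℝ)} {K : ℝ} {a : Fin M → ℝ}
    (hle : ((Measure.pi fun _ : Fin M => ν)[|l1Ball M (2 * M * τ)]).map (fun l => l + a) ≤
      ENNReal.ofReal K • π) :
    IsCentredAt π (((Measure.pi fun _ : Fin M => ν)[|l1Ball M (2 * M * τ)]).map fun l => l + a)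
      K (2 * τ ^ 2) a := by
  set p := (Measure.pi fun _ : Fin M => ν)[|l1Ball M (2 * M * τ)] with hp
  have hprob : IsProbabilityMeasure p := by
    refine cond_isProbabilityMeasure fun h0 => ?_
    have := half_le_pi_l1Ball hτ hM hi h2
    rw [measureReal_def, h0] at this
    norm_num at this
  have hm : AEMeasurable (fun l : Fin M → ℝ => l + a) p := by fun_prop
  have hmap : ∀ {F : (Fin M → ℝ) → ℝ}, Measurable F →
      ∫ l, F l ∂(p.map fun l => l + a) = ∫ l, F (l + a) ∂p := fun hF =>
    integral_map hm hF.aestronglyMeasurable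
  have hball : ∀ᵐ l ∂p, ∑ j, |l j| ≤ 2 * M * τ :=
    ae_cond_mem (measurableSet_l1Ball M (2 * M * τ))
  refine ⟨Measure.isProbabilityMeasure_map hm, hle, fun j => ?_, fun i j hij => ?_, fun j => ?_⟩
  · rw [hmap (by fun_prop)]
    simp only [Pi.add_apply]
    rw [integral_add (integrable_coord hball j) (integrable_const _),
      integral_cond_l1Ball_eq_zero hν _ j (by fun_prop) (flipCoord_self j)]
    simp
  · rw [hmap (by fun_prop)]
    simp only [Pi.add_apply, add_sub_cancel_right]
    refine integral_cond_l1Ball_eq_zero hν _ i (by fun_prop) fun l => ?_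
    rw [flipCoord_self, flipCoord_of_ne hij.symm, neg_mul]
  · rw [hmap (by fun_prop)]
    simp only [Pi.add_apply, add_sub_cancel_right]
    exact integral_cond_l1Ball_sq_le hτ hM hi h2 j

end TruncatedProduct

/-- The normalized heavy-tailed law with density proportional to `(τ² + x²)⁻²`. -/
noncomputable def heavyTailLaw (τ : ℝ) : Measure ℝ :=
  volume.withDensity fun x => ENNReal.ofReal (heavyTail τ x / ∫ y, heavyTail τ y)

section HeavyTailLaw

variable {τ : ℝ}

theorem integral_heavyTail_pos (hτ : 0 < τ) : 0 < ∫ x, heavyTail τ x :=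
  (integral_pos_iff_support_of_nonneg (fun x => (heavyTail_pos hτ x).le)
    (integrable_heavyTail hτ)).2 (by
      rw [Function.support_eq_univ fun x => (heavyTail_pos hτ x).ne']
      simp)

theorem heavyTail_div_nonneg (hτ : 0 < τ) (x : ℝ) : 0 ≤ heavyTail τ x / ∫ y, heavyTail τ y :=
  div_nonneg (heavyTail_pos hτ x).le (integral_heavyTail_pos hτ).le

theorem measurable_heavyTail_div (hτ : 0 < τ) :
    Measurable fun x => heavyTail τ x / ∫ y, heavyTail τ y :=
  (continuous_heavyTail hτ).measurable.div_const _

theorem isProbabilityMeasure_heavyTailLaw (hτ : 0 < τ) :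
    IsProbabilityMeasure (heavyTailLaw τ) := by
  constructor
  rw [heavyTailLaw, withDensity_apply _ MeasurableSet.univ, Measure.restrict_univ,
    ← ofReal_integral_eq_lintegral_ofReal ((integrable_heavyTail hτ).div_const _)
      (Filter.Eventually.of_forall (heavyTail_div_nonneg hτ)), integral_div,
    div_self (integral_heavyTail_pos hτ).ne', ENNReal.ofReal_one]

theorem measurePreserving_neg_heavyTailLaw (hτ : 0 < τ) :
    MeasurePreserving (fun x : ℝ => -x) (heavyTailLaw τ) (heavyTailLaw τ) := by
  refine ⟨measurable_neg, Measure.ext fun s hs => ?_⟩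
  have hm : Measurable fun x => ENNReal.ofReal (heavyTail τ x / ∫ y, heavyTail τ y) :=
    (measurable_heavyTail_div hτ).ennreal_ofReal
  rw [Measure.map_apply measurable_neg hs, heavyTailLaw,
    withDensity_apply _ (measurable_neg hs), withDensity_apply _ hs,
    ← (Measure.measurePreserving_neg (volume : Measure ℝ)).setLIntegral_comp_preimage hs hm]
  simp_rw [heavyTail_neg]

theorem integrable_sq_heavyTailLaw (hτ : 0 < τ) :
    Integrable (fun x : ℝ => x ^ 2) (heavyTailLaw τ) := by
  rw [heavyTailLaw, integrable_withDensity_iff_integrable_smul'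
    (measurable_heavyTail_div hτ).ennreal_ofReal (by simp)]
  refine ((integrable_sq_mul_heavyTail hτ).div_const (∫ y, heavyTail τ y)).congr
    (Filter.Eventually.of_forall fun x => ?_)
  simp only [smul_eq_mul]
  rw [ENNReal.toReal_ofReal (heavyTail_div_nonneg hτ x)]
  ring

theorem integral_sq_heavyTailLaw (hτ : 0 < τ) : ∫ x, x ^ 2 ∂heavyTailLaw τ = τ ^ 2 := by
  have h0 := (integral_heavyTail_pos hτ).ne'
  rw [heavyTailLaw, integral_withDensity_eq_integral_toReal_smul
    (measurable_heavyTail_div hτ).ennreal_ofReal (by simp)]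
  have e : ∀ x : ℝ, (ENNReal.ofReal (heavyTail τ x / ∫ y, heavyTail τ y)).toReal • x ^ 2 =
      x ^ 2 * heavyTail τ x / ∫ y, heavyTail τ y := fun x => by
    rw [ENNReal.toReal_ofReal (heavyTail_div_nonneg hτ x), smul_eq_mul]
    ring
  simp_rw [e]
  rw [integral_div, integral_sq_mul_heavyTail hτ, mul_div_cancel_right₀ _ h0]

end HeavyTailLaw

section SparsityPrior

variable {M : ℕ} {τ R c : ℝ} {π : Measure (Fin M → ℝ)}

theorem measurable_priorDensity (hτ : 0 < τ) (R c : ℝ) : Measurable fun l : Fin M → ℝ =>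
    ENNReal.ofReal (if (∑ j, |l j|) ≤ R then c * ∏ j, heavyTail τ (l j) else 0) := by
  refine Measurable.ennreal_ofReal (Measurable.ite (measurableSet_l1Ball M R) ?_ measurable_const)
  refine Measurable.const_mul ?_ c
  exact Finset.measurable_prod _ fun j _ =>
    (continuous_heavyTail hτ).measurable.comp (measurable_pi_apply j)

theorem ae_prior_mem_l1Ball (hτ : 0 < τ)
    (hπ : π = volume.withDensity fun l => ENNReal.ofReal
      (if (∑ j, |l j|) ≤ R then c * ∏ j, heavyTail τ (l j) else 0)) :
    ∀ᵐ l ∂π, ∑ j, |l j| ≤ R := by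
  rw [hπ, ae_withDensity_iff (measurable_priorDensity hτ R c)]
  refine Filter.Eventually.of_forall fun l hl => ?_
  by_contra h
  simp [h] at hl

theorem one_le_mul_integral_heavyTail_pow (hτ : 0 < τ) (hc : 0 < c)
    (hπ : π = volume.withDensity fun l => ENNReal.ofReal
      (if (∑ j, |l j|) ≤ R then c * ∏ j, heavyTail τ (l j) else 0))
    [IsProbabilityMeasure π] : 1 ≤ c * (∫ x, heavyTail τ x) ^ M := by
  have hn : ∀ l : Fin M → ℝ, 0 ≤ c * ∏ j, heavyTail τ (l j) := fun l =>
    mul_nonneg hc.le (Finset.prod_nonneg fun j _ => (heavyTail_pos hτ _).le)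
  have hi : Integrable fun l : Fin M → ℝ => c * ∏ j, heavyTail τ (l j) :=
    (Integrable.fintype_prod fun _ => integrable_heavyTail hτ).const_mul c
  have h1 : (1 : ENNReal) ≤ ENNReal.ofReal (c * (∫ x, heavyTail τ x) ^ M) := by
    calc (1 : ENNReal) = π Set.univ := measure_univ.symm
      _ = ∫⁻ l : Fin M → ℝ, ENNReal.ofReal
          (if (∑ j, |l j|) ≤ R then c * ∏ j, heavyTail τ (l j) else 0) := by
        rw [hπ, withDensity_apply _ MeasurableSet.univ, Measure.restrict_univ]
      _ ≤ ∫⁻ l : Fin M → ℝ, ENNReal.ofReal (c * ∏ j, heavyTail τ (l j)) := by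
        refine lintegral_mono fun l => ENNReal.ofReal_le_ofReal ?_
        split_ifs
        · exact le_rfl
        · exact hn l
      _ = _ := by
        rw [← ofReal_integral_eq_lintegral_ofReal hi (Filter.Eventually.of_forall hn),
          integral_const_mul, integral_fintype_prod_volume_eq_pow]
        simp
  simpa using h1

/-- The sparsity prior charges neighbourhoods of sparse vectors: there is a probability measure
centred at `a`, with coordinates of standard deviation of order `τ`, dominated by the prior. -/
theorem exists_isCentredAt (hτ : 0 < τ) (hM : 0 < M) (hc : 0 < c)
    (hπ : π = volume.withDensity fun l => ENNReal.ofReal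
      (if (∑ j, |l j|) ≤ R then c * ∏ j, heavyTail τ (l j) else 0))
    [IsProbabilityMeasure π] {a : Fin M → ℝ} (ha : ∑ j, |a j| ≤ R - 2 * M * τ) :
    ∃ p, IsCentredAt π p (2 * ∏ j, (1 + τ⁻¹ * |a j|) ^ 4) (2 * τ ^ 2) a := by
  have hprob := isProbabilityMeasure_heavyTailLaw hτ
  have hi := integrable_sq_heavyTailLaw hτ
  have h2 := (integral_sq_heavyTailLaw hτ).le
  have hA := integral_heavyTail_pos hτ
  refine ⟨_, isCentredAt_map_cond (measurePreserving_neg_heavyTailLaw hτ) hτ hM hi h2 ?_⟩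
  have hhalf := half_le_pi_l1Ball hτ hM hi h2
  set K := ∏ j, (1 + τ⁻¹ * |a j|) ^ 4 with hK
  have hK0 : 0 ≤ K := Finset.prod_nonneg fun j _ => by positivity
  set B := l1Ball M (2 * M * τ) with hB
  have hBm : MeasurableSet B := measurableSet_l1Ball M (2 * M * τ)
  set h : (Fin M → ℝ) → ENNReal := fun l => ENNReal.ofReal
    (if (∑ j, |l j|) ≤ R then c * ∏ j, heavyTail τ (l j) else 0) with hh
  have hhm : Measurable h := measurable_priorDensity hτ R c
  have hmT : Measurable fun l : Fin M → ℝ => l + a := by fun_prop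
  have hinv : (Measure.pi (fun _ : Fin M => heavyTailLaw τ) B)⁻¹ ≤ ENNReal.ofReal 2 := by
    rw [ENNReal.inv_le_iff_inv_le, ← ENNReal.ofReal_inv_of_pos two_pos,
      ENNReal.ofReal_le_iff_le_toReal (measure_ne_top _ _)]
    simpa [measureReal_def] using hhalf
  have hdens : ∀ l ∈ B, ENNReal.ofReal (∏ j, heavyTail τ (l j) / ∫ y, heavyTail τ y) ≤
      ENNReal.ofReal K * h (l + a) := fun l hl => by
    have hl' : ∑ j, |l j| ≤ 2 * M * τ := hl
    have hla : ∑ j, |(l + a) j| ≤ R := by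
      calc ∑ j, |(l + a) j| ≤ ∑ j, (|l j| + |a j|) := Finset.sum_le_sum fun j _ => abs_add_le _ _
        _ ≤ R := by rw [Finset.sum_add_distrib]; linarith
    rw [hh]
    simp only
    rw [if_pos hla, ← ENNReal.ofReal_mul hK0]
    refine ENNReal.ofReal_le_ofReal ?_
    have h1 : ∏ j, heavyTail τ (l j) ≤ K * ∏ j, heavyTail τ ((l + a) j) := by
      rw [hK, ← Finset.prod_mul_distrib]
      exact Finset.prod_le_prod (fun j _ => (heavyTail_pos hτ _).le) fun j _ =>
        heavyTail_le_mul_heavyTail_add hτ (l j) (a j)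
    have h3 : 0 ≤ ∏ j, heavyTail τ ((l + a) j) :=
      Finset.prod_nonneg fun j _ => (heavyTail_pos hτ _).le
    have h4 := one_le_mul_integral_heavyTail_pow hτ hc hπ
    rw [Finset.prod_div_distrib, Finset.prod_const, Finset.card_univ, Fintype.card_fin,
      div_le_iff₀ (pow_pos hA M)]
    nlinarith [mul_nonneg hK0 h3]
  refine Measure.le_iff.2 fun s hs => ?_
  have hsT := hmT hs
  rw [Measure.map_apply hmT hs, ProbabilityTheory.cond_apply hBm, Measure.smul_apply, smul_eq_mul]
  have hpi : Measure.pi (fun _ : Fin M => heavyTailLaw τ) = volume.withDensity fun l =>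
      ENNReal.ofReal (∏ j, heavyTail τ (l j) / ∫ y, heavyTail τ y) :=
    pi_withDensity_ofReal ((integrable_heavyTail hτ).div_const _) (heavyTail_div_nonneg hτ)
  have hbound : Measure.pi (fun _ : Fin M => heavyTailLaw τ) (B ∩ (fun l => l + a) ⁻¹' s) ≤
      ENNReal.ofReal K * π s := by
    calc Measure.pi (fun _ : Fin M => heavyTailLaw τ) (B ∩ (fun l => l + a) ⁻¹' s)
        = ∫⁻ l in B ∩ (fun l => l + a) ⁻¹' s,
            ENNReal.ofReal (∏ j, heavyTail τ (l j) / ∫ y, heavyTail τ y) := by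
          rw [hpi, withDensity_apply _ (hBm.inter hsT)]
      _ ≤ ∫⁻ l in B ∩ (fun l => l + a) ⁻¹' s, ENNReal.ofReal K * h (l + a) :=
          setLIntegral_mono' (hBm.inter hsT) fun l hl => hdens l hl.1
      _ ≤ ∫⁻ l in (fun l => l + a) ⁻¹' s, ENNReal.ofReal K * h (l + a) :=
          lintegral_mono_set Set.inter_subset_right
      _ = ENNReal.ofReal K * ∫⁻ l in s, h l := by
          have hhT : Measurable fun l => h (l + a) := hhm.comp hmT
          rw [lintegral_const_mul _ hhT,
            (measurePreserving_add_right (volume : Measure (Fin M → ℝ)) a).setLIntegral_comp_preimage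
              hs hhm]
      _ = ENNReal.ofReal K * π s := by rw [hπ, withDensity_apply _ hs]
  rw [ENNReal.ofReal_mul two_pos.le, mul_assoc]
  exact mul_le_mul' hinv hbound

end SparsityPrior

theorem lincomb_posteriorMean {ι X : Type*} [MeasurableSpace X] {M : ℕ} {μ : Measure X}
    {φ : Fin M → X → ℝ} {L R β : ℝ} {π : Measure (Fin M → ℝ)} [IsProbabilityMeasure π]
    (D : IsBoundedDictionary μ φ L) (hL : 0 ≤ L) (hβpos : 0 < β)
    (hπ : ∀ᵐ l ∂π, ∑ j, |l j| ≤ R) (s : Finset ι) (z : ι → X) (x : X) :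
    lincomb φ (posteriorMean μ φ β π s z) x =
      ∫ l, Real.exp (-(∑ i ∈ s, loss μ φ l (z i)) / β) /
        (∫ w, Real.exp (-(∑ i ∈ s, loss μ φ w (z i)) / β) ∂π) * lincomb φ l x ∂π := by
  have : IsProbabilityMeasure (π.tilted fun l => -(∑ i ∈ s, loss μ φ l (z i)) / β) :=
    isProbabilityMeasure_tilted (integrable_exp_sum_loss D hL hβpos hπ s z)
  have hac : ∀ᵐ l ∂(π.tilted fun l => -(∑ i ∈ s, loss μ φ l (z i)) / β), ∑ j, |l j| ≤ R :=
    (tilted_absolutelyContinuous _ _).ae_le hπ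
  have e := integral_tilted (μ := π) (fun l => -(∑ i ∈ s, loss μ φ l (z i)) / β)
    (fun l => lincomb φ l x)
  simp only [smul_eq_mul] at e
  rw [← e]
  unfold lincomb
  rw [integral_finsetSum _ fun j _ => (integrable_coord hac j).mul_const _]
  exact Finset.sum_congr rfl fun j _ => (integral_mul_const _ _).symm

section Risk

variable {X : Type*} [MeasurableSpace X] {M : ℕ} {μ P : Measure X} {φ : Fin M → X → ℝ}
  {f : X → ℝ} {L R β : ℝ}

theorem IsBoundedDensity.integrable_sq (F : IsBoundedDensity μ P f L) :
    Integrable (fun x => f x ^ 2) μ := by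
  refine (F.integrable.const_mul L).mono' (F.integrable.aestronglyMeasurable.pow 2) ?_
  filter_upwards [F.abs_le] with x hx
  rw [Real.norm_of_nonneg (sq_nonneg _), sq]
  exact mul_le_mul_of_nonneg_right ((le_abs_self _).trans hx) (F.nonneg x)

theorem integrable_sq_lincomb_sub (D : IsBoundedDictionary μ φ L) (F : IsBoundedDensity μ P f L)
    (l : Fin M → ℝ) : Integrable (fun x => (lincomb φ l x - f x) ^ 2) μ :=
  ((D.memLp_lincomb l).sub ((memLp_two_iff_integrable_sq
    F.integrable.aestronglyMeasurable).2 F.integrable_sq)).integrable_sq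

/-- The squared distance to the density is the expected loss up to a constant. -/
theorem integral_sq_lincomb_sub [IsProbabilityMeasure P] (D : IsBoundedDictionary μ φ L)
    (F : IsBoundedDensity μ P f L) (hL : 0 ≤ L) (l : Fin M → ℝ) :
    ∫ x, (lincomb φ l x - f x) ^ 2 ∂μ = (∫ x, loss μ φ l x ∂P) + ∫ x, f x ^ 2 ∂μ := by
  have hf2 : MemLp f 2 μ :=
    (memLp_two_iff_integrable_sq F.integrable.aestronglyMeasurable).2 F.integrable_sq
  have i1 := D.integrable_lincomb_sq l
  have i2 : Integrable (fun x => f x * lincomb φ l x) μ :=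
    MemLp.integrable_mul hf2 (D.memLp_lincomb l)
  have i3 : Integrable (fun x => lincomb φ l x ^ 2 - 2 * (f x * lincomb φ l x)) μ :=
    i1.sub (i2.const_mul 2)
  have i4 : Integrable (lincomb φ l) P := integrable_of_abs_le (D.measurable_lincomb_right l)
    (Filter.Eventually.of_forall fun x => D.abs_lincomb_le hL le_rfl x)
  have e : ∀ x, (lincomb φ l x - f x) ^ 2 =
      lincomb φ l x ^ 2 - 2 * (f x * lincomb φ l x) + f x ^ 2 := fun x => by ring
  simp_rw [e]
  rw [integral_add i3 F.integrable_sq, integral_sub i1 (i2.const_mul 2), integral_const_mul,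
    ← F.integral_eq]
  unfold loss
  rw [integral_sub (integrable_const _) (i4.const_mul 2), integral_const_mul, integral_const,
    probReal_univ, one_smul]
  rfl

theorem integral_sq_average_sub_le (D : IsBoundedDictionary μ φ L)
    (F : IsBoundedDensity μ P f L) (n : ℕ) (h : ℕ → Fin M → ℝ) :
    ∫ x, (((n : ℝ) + 1)⁻¹ * ∑ m ∈ Finset.range (n + 1), lincomb φ (h m) x - f x) ^ 2 ∂μ ≤
      ((n : ℝ) + 1)⁻¹ * ∑ m ∈ Finset.range (n + 1), ∫ x, (lincomb φ (h m) x - f x) ^ 2 ∂μ := by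
  have hi := fun m => integrable_sq_lincomb_sub D F (h m)
  rw [← integral_finsetSum _ fun m _ => hi m, ← integral_const_mul]
  refine integral_mono_of_nonneg (Filter.Eventually.of_forall fun x => sq_nonneg _)
    ((integrable_finsetSum _ fun m _ => hi m).const_mul _)
    (Filter.Eventually.of_forall fun x => ?_)
  have hn : (0 : ℝ) < (n : ℝ) + 1 := by positivity
  have e : ((n : ℝ) + 1)⁻¹ * ∑ m ∈ Finset.range (n + 1), lincomb φ (h m) x - f x =
      ((n : ℝ) + 1)⁻¹ * ∑ m ∈ Finset.range (n + 1), (lincomb φ (h m) x - f x) := by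
    rw [Finset.sum_sub_distrib, mul_sub]
    simp
    field_simp
  have hcs := sq_sum_le_card_mul_sum_sq (s := Finset.range (n + 1))
    (f := fun m => lincomb φ (h m) x - f x)
  rw [Finset.card_range, Nat.cast_succ] at hcs
  simp only
  rw [e, mul_pow, inv_pow, inv_mul_le_iff₀ (by positivity)]
  refine hcs.trans (le_of_eq ?_)
  field_simp

theorem integral_sq_aggregate_sub_le [IsProbabilityMeasure P] {n : ℕ} {τ c : ℝ}
    {π : Measure (Fin M → ℝ)} [IsProbabilityMeasure π]
    (D : IsBoundedDictionary μ φ L) (F : IsBoundedDensity μ P f L)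
    (hL : 0 ≤ L) (hτ : 0 < τ) (hM : 0 < M) (hc : 0 < c) (hβpos : 0 < β)
    (hβ : 2 * L + 4 * R * L ≤
      (β - 2 * R ^ 2) * Real.exp (-(4 * R * (L + Real.sqrt L)) / β))
    (hπ : π = volume.withDensity fun l => ENNReal.ofReal
      (if (∑ j, |l j|) ≤ R then c * ∏ j, heavyTail τ (l j) else 0))
    {a : Fin M → ℝ} (ha : ∑ j, |a j| ≤ R - 2 * M * τ) :
    ∫ z, ∫ x, (((n : ℝ) + 1)⁻¹ * ∑ m ∈ Finset.range (n + 1), lincomb φ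
        (posteriorMean μ φ β π (Finset.univ.filter fun i : Fin n => (i : ℕ) < m) z) x - f x) ^ 2
        ∂μ ∂(Measure.pi fun _ : Fin n => P) ≤
      (∫ x, (lincomb φ a x - f x) ^ 2 ∂μ) +
        (4 * β / (n + 1)) * (∑ j, Real.log (1 + τ⁻¹ * |a j|)) +
        (4 * τ ^ 2 * M + β / (n + 1)) := by
  have hn : (0 : ℝ) < (n : ℝ) + 1 := by positivity
  have hMτ : 0 ≤ 2 * M * τ := by positivity
  have haR : ∑ j, |a j| ≤ R := by linarith
  have hR : 0 ≤ R := (Finset.sum_nonneg fun j _ => abs_nonneg (a j)).trans haR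
  have hπR := ae_prior_mem_l1Ball hτ hπ
  obtain ⟨p, H⟩ := exists_isCentredAt hτ hM hc hπ ha
  set A : ℕ → Finset (Fin n) := fun m => Finset.univ.filter fun i : Fin n => (i : ℕ) < m
  have hb : ∀ j, 0 < 1 + τ⁻¹ * |a j| := fun j => by positivity
  have hK : 0 < 2 * ∏ j, (1 + τ⁻¹ * |a j|) ^ 4 :=
    mul_pos two_pos (Finset.prod_pos fun j _ => pow_pos (hb j) 4)
  have hlogK : Real.log (2 * ∏ j, (1 + τ⁻¹ * |a j|) ^ 4) ≤
      1 + 4 * ∑ j, Real.log (1 + τ⁻¹ * |a j|) := by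
    rw [Real.log_mul two_ne_zero (Finset.prod_pos fun j _ => pow_pos (hb j) 4).ne',
      Real.log_prod fun j _ => (pow_pos (hb j) 4).ne']
    simp_rw [Real.log_pow]
    rw [← Finset.mul_sum]
    have := Real.log_two_lt_d9
    push_cast
    linarith
  have hcum := (sum_integral_loss_posteriorMean_le (n := n) D F hL hR hβpos hβ hπR).trans
    (H.integral_log_partition_le (P := P) D hL hβpos hK hπR haR)
  rw [Fintype.card_fin] at hcum
  have hint := fun m => integrable_integral_loss_posteriorMean (P := P) D hL hβpos hπR (A m)
  have hint' : ∀ m, Integrable (fun z : Fin n → X =>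
      (∫ x, loss μ φ (posteriorMean μ φ β π (A m) z) x ∂P) + ∫ x, f x ^ 2 ∂μ)
      (Measure.pi fun _ => P) := fun m => (hint m).add (integrable_const _)
  have hz : ∀ z : Fin n → X, ∫ x, (((n : ℝ) + 1)⁻¹ * ∑ m ∈ Finset.range (n + 1), lincomb φ
      (posteriorMean μ φ β π (A m) z) x - f x) ^ 2 ∂μ ≤
      ((n : ℝ) + 1)⁻¹ * ∑ m ∈ Finset.range (n + 1),
        ((∫ x, loss μ φ (posteriorMean μ φ β π (A m) z) x ∂P) + ∫ x, f x ^ 2 ∂μ) := fun z => by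
    simp_rw [← integral_sq_lincomb_sub D F hL]
    exact integral_sq_average_sub_le D F n fun m => posteriorMean μ φ β π (A m) z
  have hE : ∫ z : Fin n → X, ((n : ℝ) + 1)⁻¹ * ∑ m ∈ Finset.range (n + 1),
        ((∫ x, loss μ φ (posteriorMean μ φ β π (A m) z) x ∂P) + ∫ x, f x ^ 2 ∂μ)
        ∂(Measure.pi fun _ => P) =
      ((n : ℝ) + 1)⁻¹ * (∑ m ∈ Finset.range (n + 1), ∫ z : Fin n → X,
        ∫ x, loss μ φ (posteriorMean μ φ β π (A m) z) x ∂P ∂(Measure.pi fun _ => P)) +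
        ∫ x, f x ^ 2 ∂μ := by
    rw [integral_const_mul, integral_finsetSum _ fun m _ => hint' m]
    have e : ∀ m, ∫ z : Fin n → X,
        ((∫ x, loss μ φ (posteriorMean μ φ β π (A m) z) x ∂P) + ∫ x, f x ^ 2 ∂μ)
        ∂(Measure.pi fun _ => P) = (∫ z : Fin n → X,
        ∫ x, loss μ φ (posteriorMean μ φ β π (A m) z) x ∂P ∂(Measure.pi fun _ => P)) +
        ∫ x, f x ^ 2 ∂μ := fun m => by
      rw [integral_add (hint m) (integrable_const _)]
      simp
    simp_rw [e]
    rw [Finset.sum_add_distrib, mul_add]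
    simp
    field_simp
  calc _ ≤ ∫ z : Fin n → X, ((n : ℝ) + 1)⁻¹ * ∑ m ∈ Finset.range (n + 1),
        ((∫ x, loss μ φ (posteriorMean μ φ β π (A m) z) x ∂P) + ∫ x, f x ^ 2 ∂μ)
        ∂(Measure.pi fun _ => P) :=
        integral_mono_of_nonneg
          (Filter.Eventually.of_forall fun z => integral_nonneg fun x => sq_nonneg _)
          ((integrable_finsetSum _ fun m _ => hint' m).const_mul _)
          (Filter.Eventually.of_forall hz)
    _ ≤ ((n : ℝ) + 1)⁻¹ * (β * (1 + 4 * ∑ j, Real.log (1 + τ⁻¹ * |a j|)) +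
          (n + 1) * ((∫ x, loss μ φ a x ∂P) + M * (2 * τ ^ 2))) + ∫ x, f x ^ 2 ∂μ := by
        rw [hE]
        gcongr
        refine hcum.trans ?_
        gcongr
    _ = (∫ x, (lincomb φ a x - f x) ^ 2 ∂μ) +
        (4 * β / (n + 1)) * (∑ j, Real.log (1 + τ⁻¹ * |a j|)) +
        (2 * τ ^ 2 * M + β / (n + 1)) := by
        rw [integral_sq_lincomb_sub D F hL]
        field_simp
        ring
    _ ≤ _ := by
        have : 0 ≤ τ ^ 2 * M := by positivity
        linarith

end Risk

/-- The function `g` set to zero where it exceeds `L` in absolute value. -/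
noncomputable def truncate {X : Type*} (L : ℝ) (g : X → ℝ) (x : X) : ℝ :=
  {y | |g y| ≤ L}.indicator g x

theorem truncate_of_abs_le {X : Type*} {L : ℝ} {g : X → ℝ} {x : X} (h : |g x| ≤ L) :
    truncate L g x = g x :=
  Set.indicator_of_mem (s := {y | |g y| ≤ L}) h g

theorem isBoundedDictionary_truncate {X : Type*} [MeasurableSpace X] {M : ℕ} {μ : Measure X}
    {φ : Fin M → X → ℝ} {L : ℝ} (hL : 0 ≤ L) (hm : ∀ j, Measurable (φ j))
    (h2 : ∀ j, ∫ x, φ j x ^ 2 ∂μ = 1) (hb : ∀ j, ∀ᵐ x ∂μ, |φ j x| ≤ L) :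
    IsBoundedDictionary μ (fun j => truncate L (φ j)) L where
  measurable j := (hm j).indicator (measurableSet_le (hm j).abs measurable_const)
  integral_sq j := by
    rw [← h2 j]
    refine integral_congr_ae ?_
    filter_upwards [hb j] with x hx
    rw [truncate_of_abs_le hx]
  abs_le j x := by
    by_cases h : |φ j x| ≤ L
    · rwa [truncate_of_abs_le h]
    · rw [truncate, Set.indicator_of_notMem (s := {y | |φ j y| ≤ L}) h, abs_zero]
      exact hL

theorem isBoundedDensity_of_withDensity {X : Type*} [MeasurableSpace X] {μ P : Measure X}
    {f : X → ℝ} {L : ℝ} (hf : Measurable f) (h0 : ∀ x, 0 ≤ f x)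
    (hP : P = μ.withDensity fun x => ENNReal.ofReal (f x)) [IsProbabilityMeasure P]
    (hL : ∀ᵐ x ∂μ, |f x| ≤ L) : IsBoundedDensity μ P f L where
  integrable := by
    refine ⟨hf.aestronglyMeasurable, ?_⟩
    rw [hasFiniteIntegral_iff_ofReal (Filter.Eventually.of_forall h0)]
    have : P Set.univ = ∫⁻ x, ENNReal.ofReal (f x) ∂μ := by
      rw [hP, withDensity_apply _ MeasurableSet.univ, Measure.restrict_univ]
    rw [← this]
    exact measure_lt_top P _
  nonneg := h0
  abs_le := hL
  integral_eq g := by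
    rw [hP, integral_withDensity_eq_integral_toReal_smul hf.ennreal_ofReal (by simp)]
    simp [ENNReal.toReal_ofReal (h0 _)]

end MirrorAveraging

/-- Proposition 3: In density estimation with `‖f‖_{μ,∞} ≤ L` and a temperature
`β` satisfying `(β − 2R²)e^{−4R(L+√L)/β} ≥ 2L + 4RL`, the mirror averaging aggregate with the
sparsity prior satisfies the sparsity oracle inequality (SOI1den). -/
theorem ma_density_soi
    {X : Type} [MeasurableSpace X]
    (n M : ℕ) (hM : 2 ≤ M)
    (τ R : ℝ) (hτ : 0 < τ) (hR : 2 * M * τ < R)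
    -- the reference measure μ and the density f of the observations
    (μ : Measure X) [SigmaFinite μ]
    (f : X → ℝ) (hfmeas : Measurable f) (hfnn : ∀ x, 0 ≤ f x)
    (P : Measure X) (hP : P = μ.withDensity fun x => ENNReal.ofReal (f x))
    (hPprob : IsProbabilityMeasure P)
    -- boundedness: ‖f‖_{μ,∞} ≤ L, and the normalized dictionary with ‖φ_j‖_{μ,∞} ≤ L
    (L : ℝ) (hL : 0 < L)
    (hfL : ∀ᵐ x ∂μ, |f x| ≤ L)
    (φ : Fin M → X → ℝ) (hφmeas : ∀ j, Measurable (φ j))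
    (hφnorm : ∀ j, (∫ x, φ j x ^ 2 ∂μ) = 1)
    (hφbound : ∀ j, ∀ᵐ x ∂μ, |φ j x| ≤ L)
    (flam : (Fin M → ℝ) → X → ℝ)
    (hflam : ∀ (l : Fin M → ℝ) (x : X), flam l x = ∑ j, l j * φ j x)
    -- the temperature condition
    (β : ℝ) (hβpos : 0 < β)
    (hβ : 2 * L + 4 * R * L ≤
      (β - 2 * R ^ 2) * Real.exp (-(4 * R * (L + Real.sqrt L)) / β))
    -- the sparsity prior (with normalizing constant c)
    (c : ℝ) (hc : 0 < c)
    (π : Measure (Fin M → ℝ))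
    (hπ : π = volume.withDensity fun l => ENNReal.ofReal
      (if (∑ j, |l j|) ≤ R then c * ∏ j, ((τ ^ 2 + l j ^ 2) ^ 2)⁻¹ else 0))
    (hπprob : IsProbabilityMeasure π)
    -- the mirror averaging aggregate with Q(x,g) = ‖g‖²_{μ,2} − 2g(x)
    (θ : ℕ → (Fin n → X) → (Fin M → ℝ) → ℝ)
    (hθ : ∀ (m : ℕ) (z : Fin n → X) (l : Fin M → ℝ), θ m z l =
      Real.exp (-(∑ i ∈ Finset.univ.filter (fun i : Fin n => (i : ℕ) < m),
          ((∫ t, flam l t ^ 2 ∂μ) - 2 * flam l (z i))) / β) /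
        ∫ w, Real.exp (-(∑ i ∈ Finset.univ.filter (fun i : Fin n => (i : ℕ) < m),
          ((∫ t, flam w t ^ 2 ∂μ) - 2 * flam w (z i))) / β) ∂π)
    (fhat : (Fin n → X) → X → ℝ)
    (hfhat : ∀ (z : Fin n → X) (x : X), fhat z x =
      ((n : ℝ) + 1)⁻¹ * ∑ m ∈ Finset.range (n + 1), ∫ l, θ m z l * flam l x ∂π) :
    ∀ lstar : Fin M → ℝ, (∑ j, |lstar j|) ≤ R - 2 * M * τ →
      (∫ z, ∫ x, (fhat z x - f x) ^ 2 ∂μ ∂(Measure.pi fun _ : Fin n => P)) ≤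
        (∫ x, (flam lstar x - f x) ^ 2 ∂μ) +
          (4 * β / (n + 1)) * (∑ j, Real.log (1 + τ⁻¹ * |lstar j|)) +
          (4 * τ ^ 2 * M + β / (n + 1)) := by
  intro a ha
  have hMpos : 0 < M := by omega
  have D := MirrorAveraging.isBoundedDictionary_truncate hL.le hφmeas hφnorm hφbound
  have F := MirrorAveraging.isBoundedDensity_of_withDensity hfmeas hfnn hP hfL
  set φ' : Fin M → X → ℝ := fun j => MirrorAveraging.truncate L (φ j) with hφ'
  have hπR : ∀ᵐ l ∂π, ∑ j, |l j| ≤ R := MirrorAveraging.ae_prior_mem_l1Ball hτ hπ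
  have hae : ∀ᵐ x ∂μ, ∀ l, flam l x = MirrorAveraging.lincomb φ' l x := by
    filter_upwards [ae_all_iff.2 hφbound] with x hx l
    rw [hflam]
    exact Finset.sum_congr rfl fun j _ => by
      rw [hφ']
      simp only [MirrorAveraging.truncate_of_abs_le (hx j)]
  have henergy : ∀ l, ∫ t, flam l t ^ 2 ∂μ = MirrorAveraging.energy μ φ' l := fun l =>
    integral_congr_ae (by
      filter_upwards [hae] with x hx
      rw [hx])
  have hPμ : P ≪ μ := hP ▸ withDensity_absolutelyContinuous _ _
  have hz : ∀ᵐ z ∂(Measure.pi fun _ : Fin n => P), ∀ i l,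
      flam l (z i) = MirrorAveraging.lincomb φ' l (z i) :=
    ae_all_iff.2 fun i =>
      (measurePreserving_eval (fun _ : Fin n => P) i).quasiMeasurePreserving.ae (hPμ.ae_le hae)
  have hrisk : ∫ x, (flam a x - f x) ^ 2 ∂μ =
      ∫ x, (MirrorAveraging.lincomb φ' a x - f x) ^ 2 ∂μ :=
    integral_congr_ae (by
      filter_upwards [hae] with x hx
      rw [hx])
  have hagg : ∫ z, ∫ x, (fhat z x - f x) ^ 2 ∂μ ∂(Measure.pi fun _ : Fin n => P) =
      ∫ z, ∫ x, (((n : ℝ) + 1)⁻¹ * ∑ m ∈ Finset.range (n + 1), MirrorAveraging.lincomb φ'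
        (MirrorAveraging.posteriorMean μ φ' β π
          (Finset.univ.filter fun i : Fin n => (i : ℕ) < m) z) x - f x) ^ 2
        ∂μ ∂(Measure.pi fun _ : Fin n => P) := by
    refine integral_congr_ae ?_
    filter_upwards [hz] with z hz
    refine integral_congr_ae ?_
    filter_upwards [hae] with x hx
    rw [hfhat]
    simp_rw [MirrorAveraging.lincomb_posteriorMean D hL.le hβpos hπR, hθ, henergy, hz, hx]
    rfl
  rw [hagg, hrisk]
  exact MirrorAveraging.integral_sq_aggregate_sub_le D F hL.le hτ hMpos hc hβpos hβ hπ ha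
end

section
/- In the density estimation model with ‖f‖_{μ,∞} ≤ L, if β > 0 satisfies (β − 2R²) e^{−4R(L+√L)/β} ≥ 2L + 4RL, then for every g₀, g₁, g̃ in ℱ_Λ the function t ↦ E_f[ exp( −β⁻¹{ Q(X₁, g₀ + t(g₁ − g₀)) − Q(X₁, g̃) } ) ] is concave on [0,1], where Q(x,g) = ‖g‖²_{μ,2} − 2g(x). Consequently, Assumption Q2 holds in this model with Ψ_β(g,g̃) = E_f[exp(−β⁻¹{Q(X₁,g) − Q(X₁,g̃)})]. -/
open MeasureTheory

lemma integral_linear_combination₃ {X : Type*} [MeasurableSpace X] {μ : Measure X} {u v w : X → ℝ}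
    (hu : Integrable u μ) (hv : Integrable v μ) (hw : Integrable w μ) (a b c : ℝ) :
    ∫ x, (a * u x + b * v x + c * w x) ∂μ
      = a * ∫ x, u x ∂μ + b * ∫ x, v x ∂μ + c * ∫ x, w x ∂μ := by
  have h1 : Integrable (fun x => a * u x + b * v x) μ := (hu.const_mul a).add (hv.const_mul b)
  rw [integral_add h1 (hw.const_mul c), integral_add (hu.const_mul a) (hv.const_mul b),
    integral_const_mul, integral_const_mul, integral_const_mul]

/-- Cauchy–Schwarz for real-valued square-integrable functions. -/
lemma sq_integral_mul_le {X : Type*} [MeasurableSpace X] {μ : Measure X} {u v : X → ℝ}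
    (hu : MemLp u 2 μ) (hv : MemLp v 2 μ) :
    (∫ x, u x * v x ∂μ) ^ 2 ≤ (∫ x, u x ^ 2 ∂μ) * ∫ x, v x ^ 2 ∂μ := by
  have huv : Integrable (fun x => u x * v x) μ := hu.integrable_mul hv
  have key : ∀ t : ℝ, 0 ≤ (∫ x, v x ^ 2 ∂μ) * (t * t) + (2 * ∫ x, u x * v x ∂μ) * t
      + ∫ x, u x ^ 2 ∂μ := by
    intro t
    have h0 : 0 ≤ ∫ x, (t ^ 2 * v x ^ 2 + 2 * t * (u x * v x) + 1 * u x ^ 2) ∂μ :=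
      integral_nonneg fun x => by
        have := sq_nonneg (t * v x + u x)
        simp only [Pi.zero_apply]
        nlinarith
    rw [integral_linear_combination₃ hv.integrable_sq huv hu.integrable_sq] at h0
    linarith
  have := discrim_le_zero key
  rw [discrim] at this
  nlinarith

/-- Operator-norm bound: for a probability density `ρ ≤ K` and a function `g` with `|g| ≤ G` and
`‖g‖² ≤ r`, the second moment of `h - ⟨g, h⟩` under `ρ` is at most `(K + 2G + r)‖h‖²`. -/
lemma integral_density_mul_sub_sq_le {X : Type*} [MeasurableSpace X] {μ : Measure X}
    {ρ g h : X → ℝ} {K G r : ℝ} (hK : 0 ≤ K) (hG : 0 ≤ G)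
    (hρ0 : ∀ x, 0 ≤ ρ x) (hρK : ∀ᵐ x ∂μ, ρ x ≤ K)
    (hρi : Integrable ρ μ) (hρ1 : ∫ x, ρ x ∂μ = 1)
    (hg : MemLp g 2 μ) (hh : MemLp h 2 μ) (hgG : ∀ᵐ x ∂μ, |g x| ≤ G)
    (hgr : ∫ x, g x ^ 2 ∂μ ≤ r) :
    ∫ x, ρ x * (h x - ∫ y, g y * h y ∂μ) ^ 2 ∂μ ≤ (K + 2 * G + r) * ∫ x, h x ^ 2 ∂μ := by
  set a := ∫ y, g y * h y ∂μ with ha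
  have hρn : ∀ᵐ x ∂μ, ‖ρ x‖ ≤ K := by
    filter_upwards [hρK] with x hx
    rwa [Real.norm_of_nonneg (hρ0 x)]
  have hρtop : MemLp ρ ⊤ μ := memLp_top_of_bound hρi.1 K hρn
  have hρ2 : MemLp ρ 2 μ := by
    rw [memLp_two_iff_integrable_sq hρi.1]
    simpa [sq] using hρi.bdd_mul hρi.1 hρn
  have hρh : MemLp (fun x => ρ x * h x) 2 μ := hh.mul' hρtop
  have hρhi : Integrable (fun x => ρ x * h x) μ := hρ2.integrable_mul hh
  have hρk : MemLp (fun x => ρ x * (h x - a)) 2 μ := by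
    have := hρh.sub (hρ2.const_mul a)
    convert this using 1
    ext x
    simp only [Pi.sub_apply]
    ring
  have hρki : Integrable (fun x => ρ x * (h x - a)) μ := by
    have := hρhi.sub (hρi.const_mul a)
    convert this using 1
    ext x
    simp only [Pi.sub_apply]
    ring
  have hρkh : Integrable (fun x => ρ x * (h x - a) * h x) μ := hρk.integrable_mul hh
  have hρkk : Integrable (fun x => ρ x * (h x - a) ^ 2) μ := by
    have := hρkh.sub (hρki.const_mul a)
    convert this using 1
    ext x
    simp only [Pi.sub_apply]
    ring
  have hgh : Integrable (fun x => g x * h x) μ := hg.integrable_mul hh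
  have hr : 0 ≤ r := (integral_nonneg fun x => sq_nonneg (g x)).trans hgr
  set S := ∫ x, ρ x * (h x - a) ^ 2 ∂μ with hS
  set c := ∫ x, ρ x * (h x - a) ∂μ with hc
  set N := ∫ x, h x ^ 2 ∂μ with hN
  have hS0 : 0 ≤ S := integral_nonneg fun x => mul_nonneg (hρ0 x) (sq_nonneg _)
  have hN0 : 0 ≤ N := integral_nonneg fun x => sq_nonneg _
  have hv : MemLp (fun x => ρ x * (h x - a) - c * g x) 2 μ := hρk.sub (hg.const_mul c)
  have hvh : ∫ x, (ρ x * (h x - a) - c * g x) * h x ∂μ = S := by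
    have h1 := integral_linear_combination₃ hρkk hρki hgh 1 a (-c)
    rw [← hS, ← hc, ← ha] at h1
    have h2 : ∀ x, (ρ x * (h x - a) - c * g x) * h x
        = 1 * (ρ x * (h x - a) ^ 2) + a * (ρ x * (h x - a)) + -c * (g x * h x) := fun x => by ring
    simp_rw [h2, h1]
    ring
  have hcS : c ^ 2 ≤ S := by
    have h0 : 0 ≤ ∫ x, (1 * (ρ x * (h x - a) ^ 2) + -2 * c * (ρ x * (h x - a)) + c ^ 2 * ρ x) ∂μ :=
      integral_nonneg fun x => by
        have := mul_nonneg (hρ0 x) (sq_nonneg (h x - a - c))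
        simp only [Pi.zero_apply]
        nlinarith
    rw [integral_linear_combination₃ hρkk hρki hρi, ← hS, ← hc, hρ1] at h0
    nlinarith
  have hvv : ∫ x, (ρ x * (h x - a) - c * g x) ^ 2 ∂μ ≤ (K + 2 * G + r) * S := by
    have h1 : ∫ x, (ρ x * (h x - a) - c * g x) ^ 2 ∂μ
        ≤ ∫ x, ((K + G) * (ρ x * (h x - a) ^ 2) + G * c ^ 2 * ρ x + c ^ 2 * g x ^ 2) ∂μ := by
      refine integral_mono_ae hv.integrable_sq
        (((hρkk.const_mul _).add (hρi.const_mul _)).add (hg.integrable_sq.const_mul _)) ?_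
      filter_upwards [hρK, hgG] with x h1 h2
      have h3 : ρ x * (ρ x * (h x - a) ^ 2) ≤ K * (ρ x * (h x - a) ^ 2) :=
        mul_le_mul_of_nonneg_right h1 (mul_nonneg (hρ0 x) (sq_nonneg _))
      have h4 : -2 * c * (h x - a) * g x ≤ G * (c ^ 2 + (h x - a) ^ 2) := by
        obtain ⟨h5, h6⟩ := abs_le.1 h2
        nlinarith [mul_nonneg (sub_nonneg.2 h6) (sq_nonneg (c - (h x - a))),
          mul_nonneg (by linarith : 0 ≤ G + g x) (sq_nonneg (c + (h x - a)))]
      have h5 := mul_le_mul_of_nonneg_left h4 (hρ0 x)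
      nlinarith
    rw [integral_linear_combination₃ hρkk hρi hg.integrable_sq, ← hS, hρ1] at h1
    nlinarith [mul_le_mul_of_nonneg_left hcS hG, mul_le_mul_of_nonneg_left hgr (sq_nonneg c),
      mul_le_mul_of_nonneg_left hcS hr]
  have hCS := sq_integral_mul_le hv hh
  rw [hvh, ← hN] at hCS
  rcases hS0.eq_or_lt with h0 | hpos
  · rw [← h0]
    positivity
  · have := hCS.trans (mul_le_mul_of_nonneg_right hvv hN0)
    exact le_of_mul_le_mul_left (by linarith) hpos

/-- Concavity on `[0, 1]` of a Gaussian-type factor times a moment generating function, from the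
sign of its second derivative. -/
lemma concaveOn_exp_quadratic_mul_integral_exp {X : Type*} [MeasurableSpace X] {ν : Measure X}
    [IsFiniteMeasure ν] {h : X → ℝ} {B : ℝ} (hm : AEMeasurable h ν) (hB : ∀ᵐ x ∂ν, |h x| ≤ B)
    {s c p N : ℝ} (hs : 0 ≤ s)
    (H : ∀ t ∈ Set.Ioo (0 : ℝ) 1,
      s * ∫ x, (h x - (p + t * N)) ^ 2 * Real.exp (s * t * h x) ∂ν
        ≤ N * ∫ x, Real.exp (s * t * h x) ∂ν) :
    ConcaveOn ℝ (Set.Icc (0 : ℝ) 1) fun t =>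
      Real.exp (c - s * (p * t + N * t ^ 2 / 2)) * ∫ x, Real.exp (s * t * h x) ∂ν := by
  have hmem : ∀ t : ℝ, t ∈ interior (ProbabilityTheory.integrableExpSet h ν) := by
    have : ProbabilityTheory.integrableExpSet h ν = Set.univ := Set.eq_univ_of_forall fun t =>
      ProbabilityTheory.integrable_exp_mul_of_mem_Icc hm (hB.mono fun x hx => abs_le.1 hx)
    simp [this]
  let m : ℕ → ℝ → ℝ := fun n t => ∫ x, h x ^ n * Real.exp (t * h x) ∂ν
  have hI : ∀ n t, Integrable (fun x => h x ^ n * Real.exp (t * h x)) ν := fun n t =>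
    ProbabilityTheory.integrable_pow_mul_exp_of_mem_interior_integrableExpSet (hmem t) n
  have hm0 : ∀ n t, HasDerivAt (fun t => m n (s * t)) (m (n + 1) (s * t) * s) t := fun n t =>
    (ProbabilityTheory.hasDerivAt_integral_pow_mul_exp_real (hmem (s * t)) n).comp t
      (by simpa using (hasDerivAt_id t).const_mul s)
  let E : ℝ → ℝ := fun t => Real.exp (c - s * (p * t + N * t ^ 2 / 2))
  have hE : ∀ t, HasDerivAt E (E t * (-s * (p + t * N))) t := by
    intro t
    have h1 : HasDerivAt (fun t : ℝ => c - s * (p * t + N * t ^ 2 / 2)) (-s * (p + t * N)) t := by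
      have := ((((hasDerivAt_id t).const_mul p).add
        ((((hasDerivAt_id t).pow 2).const_mul N).div_const 2)).const_mul s).const_sub c
      convert! this using 1
      simp only [id_eq, Nat.cast_ofNat, Nat.add_one_sub_one, pow_one]
      ring
    exact h1.exp
  have hl : ∀ t, HasDerivAt (fun t : ℝ => -s * (p + t * N)) (-s * N) t := by
    intro t
    have := (((hasDerivAt_id t).mul_const N).const_add p).const_mul (-s)
    simpa using this
  have hF : ∀ t, HasDerivAt (fun t => E t * m 0 (s * t))
      (E t * (-s * (p + t * N)) * m 0 (s * t) + E t * (m 1 (s * t) * s)) t := fun t =>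
    (hE t).mul (hm0 0 t)
  have hF' := fun t => (((hE t).mul (hl t)).mul (hm0 0 t)).add ((hE t).mul ((hm0 1 t).mul_const s))
  have hgoal : ConcaveOn ℝ (Set.Icc (0 : ℝ) 1) fun t => E t * m 0 (s * t) := by
    refine concaveOn_of_hasDerivWithinAt2_nonpos (convex_Icc 0 1)
      (fun t _ => (hF t).continuousAt.continuousWithinAt)
      (fun t _ => (hF t).hasDerivWithinAt) (fun t _ => (hF' t).hasDerivWithinAt) ?_
    intro t ht
    rw [interior_Icc] at ht
    have h1 := H t ht
    have h2 : ∫ x, (h x - (p + t * N)) ^ 2 * Real.exp (s * t * h x) ∂ν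
        = m 2 (s * t) - 2 * (p + t * N) * m 1 (s * t) + (p + t * N) ^ 2 * m 0 (s * t) := by
      have := integral_linear_combination₃ (hI 2 (s * t)) (hI 1 (s * t)) (hI 0 (s * t))
        1 (-2 * (p + t * N)) ((p + t * N) ^ 2)
      rw [show m 2 (s * t) - 2 * (p + t * N) * m 1 (s * t) + (p + t * N) ^ 2 * m 0 (s * t)
        = 1 * m 2 (s * t) + -2 * (p + t * N) * m 1 (s * t) + (p + t * N) ^ 2 * m 0 (s * t) by ring,
        ← this]
      congr 1
      ext x
      ring
    have h3 : ∫ x, Real.exp (s * t * h x) ∂ν = m 0 (s * t) := by simp [m]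
    rw [h2, h3] at h1
    have h4 := mul_le_mul_of_nonneg_left h1 (mul_nonneg hs (Real.exp_pos _).le :
      0 ≤ s * E t)
    simp only [Nat.reduceAdd, zero_add, Pi.mul_apply]
    linarith
  simpa [m, E] using hgoal

lemma exp_integral_le_integral_exp {X : Type*} [MeasurableSpace X] {P : Measure X}
    [IsProbabilityMeasure P] {y : X → ℝ} (hy : Integrable y P)
    (hey : Integrable (fun x => Real.exp (y x)) P) :
    Real.exp (∫ x, y x ∂P) ≤ ∫ x, Real.exp (y x) ∂P :=
  convexOn_exp.map_integral_le Real.continuous_exp.continuousOn isClosed_univ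
    (Filter.Eventually.of_forall fun _ => Set.mem_univ _) hy hey

/-- The exponential weight `exp (s d)` is controlled by its mean when `d` is bounded and has
a controlled second moment. -/
lemma ae_exp_le_mul_integral_exp {X : Type*} [MeasurableSpace X] {P : Measure X}
    [IsProbabilityMeasure P] {d : X → ℝ} {s B C : ℝ} (hs : 0 ≤ s) (hC : 0 ≤ C)
    (hd : Measurable d) (hB : ∀ᵐ x ∂P, |d x| ≤ B) (h2 : ∫ x, d x ^ 2 ∂P ≤ C ^ 2) :
    ∀ᵐ x ∂P, Real.exp (s * d x) ≤ Real.exp (s * (B + C)) * ∫ x, Real.exp (s * d x) ∂P := by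
  have hL2 : MemLp d 2 P := MemLp.of_bound hd.aestronglyMeasurable B hB
  have hdi : Integrable d P := hL2.integrable (by norm_num)
  have hCS := sq_integral_mul_le hL2 (memLp_const (1 : ℝ))
  simp only [mul_one, one_pow, integral_const, probReal_univ, smul_eq_mul] at hCS
  have hlow : -C ≤ ∫ x, d x ∂P := (abs_le.1 (abs_le_of_sq_le_sq (hCS.trans h2) hC)).1
  have hJ := exp_integral_le_integral_exp (hdi.const_mul s)
    (ProbabilityTheory.integrable_exp_mul_of_mem_Icc hd.aemeasurable
      (hB.mono fun x hx => abs_le.1 hx))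
  rw [integral_const_mul] at hJ
  filter_upwards [hB] with x hx
  calc Real.exp (s * d x) ≤ Real.exp (s * (B + C) + s * ∫ x, d x ∂P) := by
        rw [Real.exp_le_exp, ← mul_add]
        exact mul_le_mul_of_nonneg_left (by linarith [(abs_le.1 hx).2]) hs
    _ ≤ _ := by
        rw [Real.exp_add]
        gcongr

lemma integral_withDensity_ofReal {X : Type*} [MeasurableSpace X] {μ : Measure X} {f : X → ℝ}
    (hf : Measurable f) (hf0 : ∀ x, 0 ≤ f x) (u : X → ℝ) :
    ∫ x, u x ∂(μ.withDensity fun x => ENNReal.ofReal (f x)) = ∫ x, f x * u x ∂μ := by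
  rw [integral_withDensity_eq_integral_toReal_smul hf.ennreal_ofReal (by simp)]
  simp [hf0]

/-- A combination of unit vectors bounded by `L` with coefficients of `ℓ¹` norm at most `r` is
bounded by `r * L` and has squared norm at most `r ^ 2`. -/
lemma dictionary_combination_bounds {X ι : Type*} [Fintype ι] [MeasurableSpace X] {μ : Measure X}
    {φ : ι → X → ℝ} {L : ℝ} (hL : 0 ≤ L) (hφm : ∀ j, Measurable (φ j))
    (hφ1 : ∀ j, ∫ x, φ j x ^ 2 ∂μ = 1) (hφL : ∀ j, ∀ᵐ x ∂μ, |φ j x| ≤ L) {l : ι → ℝ} {r : ℝ}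
    (hl : ∑ j, |l j| ≤ r) :
    MemLp (fun x => ∑ j, l j * φ j x) 2 μ ∧ (∀ᵐ x ∂μ, |∑ j, l j * φ j x| ≤ r * L) ∧
      ∫ x, (∑ j, l j * φ j x) ^ 2 ∂μ ≤ r ^ 2 := by
  have hφ2 : ∀ j, MemLp (φ j) 2 μ := fun j => by
    rw [memLp_two_iff_integrable_sq (hφm j).aestronglyMeasurable]
    by_contra hn
    have := hφ1 j
    rw [integral_undef hn] at this
    norm_num at this
  have hg2 : MemLp (fun x => ∑ j, l j * φ j x) 2 μ :=
    memLp_finsetSum _ fun j _ => (hφ2 j).const_mul (l j)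
  have hS0 : 0 ≤ ∑ j, |l j| := Finset.sum_nonneg fun j _ => abs_nonneg _
  refine ⟨hg2, ?_, ?_⟩
  · filter_upwards [ae_all_iff.2 hφL] with x hx
    calc |∑ j, l j * φ j x| ≤ ∑ j, |l j * φ j x| := Finset.abs_sum_le_sum_abs _ _
      _ ≤ ∑ j, |l j| * L := Finset.sum_le_sum fun j _ => by
          rw [abs_mul]
          exact mul_le_mul_of_nonneg_left (hx j) (abs_nonneg _)
      _ ≤ r * L := by
          rw [← Finset.sum_mul]
          exact mul_le_mul_of_nonneg_right hl hL
  · have hint : ∀ j, Integrable (fun x => |l j| * φ j x ^ 2) μ := fun j =>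
      (hφ2 j).integrable_sq.const_mul _
    have h1 : ∫ x, (∑ j, l j * φ j x) ^ 2 ∂μ
        ≤ ∫ x, (∑ j, |l j|) * ∑ j, |l j| * φ j x ^ 2 ∂μ := by
      refine integral_mono hg2.integrable_sq
        ((integrable_finsetSum _ fun j _ => hint j).const_mul _) fun x => ?_
      refine Finset.sum_sq_le_sum_mul_sum_of_sq_le_mul _ (fun j _ => abs_nonneg _)
        (fun j _ => by positivity) fun j _ => ?_
      rw [← mul_assoc, abs_mul_abs_self]
      exact le_of_eq (by ring)
    rw [integral_const_mul, integral_finsetSum _ fun j _ => hint j] at h1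
    simp only [integral_const_mul, hφ1, mul_one] at h1
    nlinarith

/-- Concavity of the exponential criterion along a segment, for a bounded density. -/
lemma concaveOn_integral_exp_segment {X : Type*} [MeasurableSpace X] {μ : Measure X}
    {f g₀ g₁ g' : X → ℝ} {L G r B D β : ℝ} (hfm : Measurable f) (hf0 : ∀ x, 0 ≤ f x)
    (hfL : ∀ᵐ x ∂μ, f x ≤ L)
    (hP : IsProbabilityMeasure (μ.withDensity fun x => ENNReal.ofReal (f x)))
    (hL : 0 ≤ L) (hG : 0 ≤ G) (hD : 0 ≤ D) (hβ0 : 0 < β)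
    (hm₀ : Measurable g₀) (hm₁ : Measurable g₁) (hm' : Measurable g')
    (h2₀ : MemLp g₀ 2 μ) (h2₁ : MemLp g₁ 2 μ) (h2' : MemLp g' 2 μ)
    (hgG : ∀ t ∈ Set.Icc (0 : ℝ) 1, ∀ᵐ x ∂μ, |g₀ x + t * (g₁ x - g₀ x)| ≤ G)
    (hgr : ∀ t ∈ Set.Icc (0 : ℝ) 1, ∫ x, (g₀ x + t * (g₁ x - g₀ x)) ^ 2 ∂μ ≤ r)
    (hdB : ∀ t ∈ Set.Icc (0 : ℝ) 1, ∀ᵐ x ∂μ, |g₀ x + t * (g₁ x - g₀ x) - g' x| ≤ B)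
    (hdD : ∀ t ∈ Set.Icc (0 : ℝ) 1, ∫ x, (g₀ x + t * (g₁ x - g₀ x) - g' x) ^ 2 ∂μ ≤ D ^ 2)
    (hβ : 2 * (L * Real.exp (2 / β * (B + Real.sqrt L * D)) + 2 * G + r) ≤ β) :
    ConcaveOn ℝ (Set.Icc (0 : ℝ) 1) fun t : ℝ =>
      ∫ x, Real.exp (-((∫ y, (g₀ y + t * (g₁ y - g₀ y)) ^ 2 ∂μ - 2 * (g₀ x + t * (g₁ x - g₀ x)))
        - (∫ y, g' y ^ 2 ∂μ - 2 * g' x)) / β) ∂(μ.withDensity fun x => ENNReal.ofReal (f x)) := by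
  set P := μ.withDensity fun x => ENNReal.ofReal (f x) with hPdef
  have hPac : P ≪ μ := withDensity_absolutelyContinuous _ _
  have hPint : ∀ u : X → ℝ, ∫ x, u x ∂P = ∫ x, f x * u x ∂μ :=
    integral_withDensity_ofReal hfm hf0
  have hfi : Integrable f μ := by
    have := integrable_const (μ := P) (1 : ℝ)
    rw [hPdef, integrable_withDensity_iff_integrable_smul' hfm.ennreal_ofReal (by simp)] at this
    simpa [hf0] using this
  have h0mem : (0 : ℝ) ∈ Set.Icc (0 : ℝ) 1 := ⟨le_rfl, zero_le_one⟩
  have h1mem : (1 : ℝ) ∈ Set.Icc (0 : ℝ) 1 := ⟨zero_le_one, le_rfl⟩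
  set s := 2 / β with hs
  have hs0 : 0 ≤ s := by positivity
  let h : X → ℝ := fun x => g₁ x - g₀ x
  have hhm : Measurable h := hm₁.sub hm₀
  have hh2 : MemLp h 2 μ := h2₁.sub h2₀
  have hg2 : ∀ t : ℝ, MemLp (fun x => g₀ x + t * h x) 2 μ := fun t => h2₀.add (hh2.const_mul t)
  have hgm : ∀ t : ℝ, Measurable (fun x => g₀ x + t * h x) := fun t => by fun_prop
  have hgh : Integrable (fun x => g₀ x * h x) μ := h2₀.integrable_mul hh2
  let p := ∫ x, g₀ x * h x ∂μ
  let N := ∫ x, h x ^ 2 ∂μ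
  let q := ∫ x, g₀ x ^ 2 ∂μ
  have hq : ∀ t : ℝ, ∫ x, (g₀ x + t * h x) ^ 2 ∂μ = q + 2 * t * p + t ^ 2 * N := by
    intro t
    have := integral_linear_combination₃ h2₀.integrable_sq hgh hh2.integrable_sq 1 (2 * t) (t ^ 2)
    rw [one_mul] at this
    rw [← this]
    congr 1
    ext x
    ring
  have ha : ∀ t : ℝ, ∫ x, (g₀ x + t * h x) * h x ∂μ = p + t * N := by
    intro t
    rw [← integral_const_mul, ← integral_add hgh (hh2.integrable_sq.const_mul t)]
    congr 1
    ext x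
    ring
  have hw : Measurable fun x => f x * Real.exp (s * (g₀ x - g' x)) := by fun_prop
  have hw0 : ∀ x, 0 ≤ f x * Real.exp (s * (g₀ x - g' x)) := fun x =>
    mul_nonneg (hf0 x) (Real.exp_pos _).le
  have hexpi : ∀ t ∈ Set.Icc (0 : ℝ) 1,
      Integrable (fun x => f x * Real.exp (s * (g₀ x + t * h x - g' x))) μ := by
    intro t ht
    refine hfi.mul_bdd (c := Real.exp (s * B)) (by fun_prop) ?_
    filter_upwards [hdB t ht] with x hx
    rw [Real.norm_of_nonneg (Real.exp_pos _).le, Real.exp_le_exp]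
    exact mul_le_mul_of_nonneg_left (abs_le.1 hx).2 hs0
  let ν := μ.withDensity fun x => ENNReal.ofReal (f x * Real.exp (s * (g₀ x - g' x)))
  have hνint : ∀ u : X → ℝ, ∫ x, u x ∂ν = ∫ x, f x * Real.exp (s * (g₀ x - g' x)) * u x ∂μ :=
    integral_withDensity_ofReal hw hw0
  have hνfin : IsFiniteMeasure ν := by
    have := hexpi 0 h0mem
    simp only [zero_mul, add_zero] at this
    exact isFiniteMeasure_withDensity_ofReal this.2
  have hhB : ∀ᵐ x ∂ν, |h x| ≤ 2 * G := by
    refine (withDensity_absolutelyContinuous μ _).ae_le ?_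
    filter_upwards [hgG 0 h0mem, hgG 1 h1mem] with x hx0 hx1
    have h3 : h x = (g₀ x + 1 * (g₁ x - g₀ x)) - (g₀ x + 0 * (g₁ x - g₀ x)) := by
      simp only [h]
      ring
    rw [h3]
    exact (abs_sub _ _).trans (by linarith)
  have hweight : ∀ t x, f x * Real.exp (s * (g₀ x - g' x)) * Real.exp (s * t * h x)
      = f x * Real.exp (s * (g₀ x + t * h x - g' x)) := fun t x => by
    rw [mul_assoc, ← Real.exp_add]
    ring_nf
  have hconc := concaveOn_exp_quadratic_mul_integral_exp (ν := ν) (s := s)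
    (c := -(q - ∫ x, g' x ^ 2 ∂μ) / β) (p := p) (N := N) hhm.aemeasurable hhB hs0 ?_
  · convert hconc using 2 with t
    rw [hPint, hνint, ← integral_const_mul]
    congr 1
    ext x
    rw [hweight, mul_left_comm, ← Real.exp_add]
    congr 2
    rw [show (∫ y, (g₀ y + t * (g₁ y - g₀ y)) ^ 2 ∂μ) = q + 2 * t * p + t ^ 2 * N from hq t, hs]
    simp only [h]
    ring
  · intro t ht
    have ht' := Set.Ioo_subset_Icc_self ht
    rw [hνint, hνint]
    simp_rw [hweight t]
    set W := ∫ x, f x * Real.exp (s * (g₀ x + t * h x - g' x)) ∂μ with hW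
    have hN0 : 0 ≤ N := integral_nonneg fun x => sq_nonneg _
    have hsup : ∀ᵐ x ∂P, Real.exp (s * (g₀ x + t * h x - g' x))
        ≤ Real.exp (s * (B + Real.sqrt L * D)) * W := by
      rw [hW, ← hPint]
      refine ae_exp_le_mul_integral_exp hs0 (by positivity) ((hgm t).sub hm')
        (hPac.ae_le (hdB t ht')) ?_
      have hd2 : Integrable (fun x => (g₀ x + t * h x - g' x) ^ 2) μ :=
        ((hg2 t).sub h2').integrable_sq
      rw [hPint, mul_pow, Real.sq_sqrt hL]
      calc ∫ x, f x * (g₀ x + t * h x - g' x) ^ 2 ∂μ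
          ≤ ∫ x, L * (g₀ x + t * h x - g' x) ^ 2 ∂μ := by
            refine integral_mono_ae (hd2.bdd_mul (c := L) hfm.aestronglyMeasurable ?_)
              (hd2.const_mul L) ?_
            · filter_upwards [hfL] with x hx
              rwa [Real.norm_of_nonneg (hf0 x)]
            · filter_upwards [hfL] with x hx
              exact mul_le_mul_of_nonneg_right hx (sq_nonneg _)
        _ ≤ L * D ^ 2 := by
            rw [integral_const_mul]
            exact mul_le_mul_of_nonneg_left (hdD t ht') hL
    have hWpos : 0 < W := by
      obtain ⟨x, hx⟩ := hsup.exists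
      exact pos_of_mul_pos_right ((Real.exp_pos _).trans_le hx) (Real.exp_pos _).le
    have hcore := integral_density_mul_sub_sq_le (μ := μ)
      (ρ := fun x => f x * Real.exp (s * (g₀ x + t * h x - g' x)) / W)
      (g := fun x => g₀ x + t * h x) (h := h) (G := G) (r := r)
      (K := L * Real.exp (s * (B + Real.sqrt L * D))) (by positivity) hG
      (fun x => div_nonneg (mul_nonneg (hf0 x) (Real.exp_pos _).le) hWpos.le) ?_
      ((hexpi t ht').div_const W) (by rw [integral_div, ← hW, div_self hWpos.ne'])
      (hg2 t) hh2 (hgG t ht') (hgr t ht')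
    · simp only [ha t, div_mul_eq_mul_div, integral_div] at hcore
      rw [div_le_iff₀ hWpos] at hcore
      have h3 := mul_le_mul_of_nonneg_left hcore hs0
      have h4 : s * (L * Real.exp (s * (B + Real.sqrt L * D)) + 2 * G + r) ≤ 1 := by
        rw [hs, div_mul_eq_mul_div, div_le_one hβ0]
        exact hβ
      have h5 := mul_le_mul_of_nonneg_right h4 (mul_nonneg hN0 hWpos.le)
      have h6 : ∀ x, f x * Real.exp (s * (g₀ x - g' x)) *
          ((h x - (p + t * N)) ^ 2 * Real.exp (s * t * h x))
          = f x * Real.exp (s * (g₀ x + t * h x - g' x)) * (h x - (p + t * N)) ^ 2 := fun x => by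
        rw [← hweight]
        ring
      simp_rw [h6]
      linarith
    · have hsup' := (ae_withDensity_iff hfm.ennreal_ofReal).1 hsup
      filter_upwards [hsup', hfL] with x hx hxL
      rw [div_le_iff₀ hWpos]
      rcases (hf0 x).eq_or_lt with h0 | hpos
      · rw [← h0, zero_mul]
        positivity
      · have := hx (by simpa using hpos)
        calc _ ≤ L * (Real.exp (s * (B + Real.sqrt L * D)) * W) :=
              mul_le_mul hxL this (Real.exp_pos _).le hL
          _ = _ := by ring



/-- In the density estimation model with `‖f‖_{μ,∞} ≤ L` and
`(β − 2R²)e^{−4R(L+√L)/β} ≥ 2L + 4RL`, for all `g₀, g₁, g̃ ∈ ℱ_Λ` the map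
`t ↦ E_f[exp(−β⁻¹{Q(X₁, g₀ + t(g₁ − g₀)) − Q(X₁, g̃)})]` is concave on `[0,1]`, where
`Q(x,g) = ‖g‖²_{μ,2} − 2g(x)`.  Consequently Assumption Q2 holds with
`Ψ_β(g,g̃) = E_f[exp(−β⁻¹{Q(X₁,g) − Q(X₁,g̃)})]`. -/
theorem density_Q2_concavity
    {X : Type} [MeasurableSpace X]
    (M : ℕ) (R : ℝ) (hRpos : 0 < R)
    (μ : Measure X) [SigmaFinite μ]
    (f : X → ℝ) (hfmeas : Measurable f) (hfnn : ∀ x, 0 ≤ f x)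
    (P : Measure X) (hP : P = μ.withDensity fun x => ENNReal.ofReal (f x))
    (hPprob : IsProbabilityMeasure P)
    (L : ℝ) (hL : 0 < L)
    (hfL : ∀ᵐ x ∂μ, |f x| ≤ L)
    (φ : Fin M → X → ℝ) (hφmeas : ∀ j, Measurable (φ j))
    (hφnorm : ∀ j, (∫ x, φ j x ^ 2 ∂μ) = 1)
    (hφbound : ∀ j, ∀ᵐ x ∂μ, |φ j x| ≤ L)
    (flam : (Fin M → ℝ) → X → ℝ)
    (hflam : ∀ (l : Fin M → ℝ) (x : X), flam l x = ∑ j, l j * φ j x)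
    -- the convex dictionary class ℱ_Λ
    (FΛ : Set (X → ℝ))
    (hFΛ : FΛ = {g | ∃ l : Fin M → ℝ, (∑ j, |l j|) ≤ R ∧ g = flam l})
    -- Q(x,g) = ‖g‖²_{μ,2} − 2 g(x)
    (Q : X → (X → ℝ) → ℝ)
    (hQ : ∀ (x : X) (g : X → ℝ), Q x g = (∫ t, g t ^ 2 ∂μ) - 2 * g x)
    (β : ℝ) (hβpos : 0 < β)
    (hβ : 2 * L + 4 * R * L ≤
      (β - 2 * R ^ 2) * Real.exp (-(4 * R * (L + Real.sqrt L)) / β))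
    (Ψ : (X → ℝ) → (X → ℝ) → ℝ)
    (hΨ : ∀ g g' : X → ℝ, Ψ g g' = ∫ x, Real.exp (-(Q x g - Q x g') / β) ∂P) :
    (∀ g₀ ∈ FΛ, ∀ g₁ ∈ FΛ, ∀ g' ∈ FΛ,
      ConcaveOn ℝ (Set.Icc (0 : ℝ) 1) fun t : ℝ =>
        ∫ x, Real.exp (-(Q x (g₀ + t • (g₁ - g₀)) - Q x g') / β) ∂P) ∧
    (∀ g ∈ FΛ, Ψ g g = 1) ∧
    (∀ g' ∈ FΛ, ConcaveOn ℝ FΛ fun g => Ψ g g') ∧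
    (∀ g ∈ FΛ, ∀ g' ∈ FΛ,
      (∫ x, Real.exp (-(Q x g - Q x g') / β) ∂P) ≤ Ψ g g') := by
  subst hP
  have hcomb := fun (l : Fin M → ℝ) (r : ℝ) (hl : ∑ j, |l j| ≤ r) =>
    dictionary_combination_bounds hL.le hφmeas hφnorm hφbound hl
  have hmeas : ∀ l : Fin M → ℝ, Measurable fun x => ∑ j, l j * φ j x := fun l => by fun_prop
  have hflam' : ∀ l, flam l = fun x => ∑ j, l j * φ j x := fun l => funext (hflam l)
  have hbudget : 2 * (L * Real.exp (2 / β * (2 * R * L + Real.sqrt L * (2 * R)))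
      + 2 * (R * L) + R ^ 2) ≤ β := by
    set e := Real.exp (2 / β * (2 * R * L + Real.sqrt L * (2 * R))) with he
    have he1 : 1 ≤ e := Real.one_le_exp (by positivity)
    have hexp : Real.exp (-(4 * R * (L + Real.sqrt L)) / β) * e = 1 := by
      rw [he, ← Real.exp_add, Real.exp_eq_one_iff]
      ring
    have h1 := mul_le_mul_of_nonneg_right hβ (zero_le_one.trans he1)
    rw [mul_assoc (β - 2 * R ^ 2), hexp, mul_one] at h1
    nlinarith [mul_le_mul_of_nonneg_left he1 (by positivity : 0 ≤ 4 * R * L)]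
  have hsegl : ∀ l₀ l₁ : Fin M → ℝ, ∑ j, |l₀ j| ≤ R → ∑ j, |l₁ j| ≤ R →
      ∀ t ∈ Set.Icc (0 : ℝ) 1, ∑ j, |l₀ j + t * (l₁ j - l₀ j)| ≤ R := by
    intro l₀ l₁ h₀ h₁ t ht
    calc ∑ j, |l₀ j + t * (l₁ j - l₀ j)| ≤ ∑ j, ((1 - t) * |l₀ j| + t * |l₁ j|) :=
          Finset.sum_le_sum fun j _ => by
            rw [show l₀ j + t * (l₁ j - l₀ j) = (1 - t) * l₀ j + t * l₁ j by ring]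
            refine (abs_add_le _ _).trans_eq ?_
            rw [abs_mul, abs_mul, abs_of_nonneg ht.1, abs_of_nonneg (sub_nonneg.2 ht.2)]
      _ ≤ R := by
          rw [Finset.sum_add_distrib, ← Finset.mul_sum, ← Finset.mul_sum]
          nlinarith [mul_le_mul_of_nonneg_left h₀ (sub_nonneg.2 ht.2),
            mul_le_mul_of_nonneg_left h₁ ht.1]
  have hseg : ∀ (l₀ l₁ : Fin M → ℝ) (t : ℝ) (x : X),
      (∑ j, l₀ j * φ j x) + t * ((∑ j, l₁ j * φ j x) - ∑ j, l₀ j * φ j x)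
        = ∑ j, (l₀ j + t * (l₁ j - l₀ j)) * φ j x := fun l₀ l₁ t x => by
    rw [← Finset.sum_sub_distrib, Finset.mul_sum, ← Finset.sum_add_distrib]
    exact Finset.sum_congr rfl fun j _ => by ring
  have hmain : ∀ g₀ ∈ FΛ, ∀ g₁ ∈ FΛ, ∀ g' ∈ FΛ,
      ConcaveOn ℝ (Set.Icc (0 : ℝ) 1) fun t : ℝ =>
        ∫ x, Real.exp (-(Q x (g₀ + t • (g₁ - g₀)) - Q x g') / β)
          ∂(μ.withDensity fun x => ENNReal.ofReal (f x)) := by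
    subst hFΛ
    rintro _ ⟨l₀, h₀, rfl⟩ _ ⟨l₁, h₁, rfl⟩ _ ⟨l', h', rfl⟩
    have hdiffl : ∀ t ∈ Set.Icc (0 : ℝ) 1,
        ∑ j, |l₀ j + t * (l₁ j - l₀ j) - l' j| ≤ 2 * R := fun t ht =>
      calc ∑ j, |l₀ j + t * (l₁ j - l₀ j) - l' j|
          ≤ ∑ j, (|l₀ j + t * (l₁ j - l₀ j)| + |l' j|) :=
            Finset.sum_le_sum fun j _ => abs_sub _ _
        _ ≤ 2 * R := by
            rw [Finset.sum_add_distrib]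
            linarith [hsegl l₀ l₁ h₀ h₁ t ht]
    have hdiff : ∀ (t : ℝ) (x : X),
        (∑ j, (l₀ j + t * (l₁ j - l₀ j)) * φ j x) - ∑ j, l' j * φ j x
          = ∑ j, (l₀ j + t * (l₁ j - l₀ j) - l' j) * φ j x := fun t x => by
      rw [← Finset.sum_sub_distrib]
      exact Finset.sum_congr rfl fun j _ => by ring
    simp only [hQ, hflam', Pi.add_apply, Pi.smul_apply, Pi.sub_apply, smul_eq_mul]
    refine concaveOn_integral_exp_segment (G := R * L) (r := R ^ 2) (B := 2 * R * L)
      (D := 2 * R) hfmeas hfnn (hfL.mono fun x hx => (le_abs_self _).trans hx) hPprob hL.le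
      (by positivity) (by positivity) hβpos (hmeas l₀) (hmeas l₁) (hmeas l') (hcomb l₀ R h₀).1
      (hcomb l₁ R h₁).1 (hcomb l' R h').1 ?_ ?_ ?_ ?_ hbudget <;> intro t ht
    · simp only [hseg]
      exact (hcomb _ R (hsegl l₀ l₁ h₀ h₁ t ht)).2.1
    · simp only [hseg]
      exact (hcomb _ R (hsegl l₀ l₁ h₀ h₁ t ht)).2.2
    · simp only [hseg, hdiff]
      exact (hcomb _ (2 * R) (hdiffl t ht)).2.1
    · simp only [hseg, hdiff]
      exact (hcomb _ (2 * R) (hdiffl t ht)).2.2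
  have hsegmem : ∀ g₀ ∈ FΛ, ∀ g₁ ∈ FΛ, ∀ t ∈ Set.Icc (0 : ℝ) 1, g₀ + t • (g₁ - g₀) ∈ FΛ := by
    subst hFΛ
    rintro _ ⟨l₀, h₀, rfl⟩ _ ⟨l₁, h₁, rfl⟩ t ht
    refine ⟨fun j => l₀ j + t * (l₁ j - l₀ j), hsegl l₀ l₁ h₀ h₁ t ht, ?_⟩
    ext x
    simp only [hflam', Pi.add_apply, Pi.smul_apply, Pi.sub_apply, smul_eq_mul, hseg]
  have hsegment_eq : ∀ (g₀ g₁ : X → ℝ) (a b : ℝ), a + b = 1 →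
      a • g₀ + b • g₁ = g₀ + b • (g₁ - g₀) := fun g₀ g₁ a b hab => by
    rw [show a = 1 - b by linarith]
    module
  refine ⟨hmain, fun g _ => by simp [hΨ], fun g' hg' => ⟨?_, ?_⟩, fun g _ g' _ => (hΨ g g').ge⟩
  · intro g₀ h₀ g₁ h₁ a b ha hb hab
    rw [hsegment_eq g₀ g₁ a b hab]
    exact hsegmem g₀ h₀ g₁ h₁ b ⟨hb, by linarith⟩
  · intro g₀ h₀ g₁ h₁ a b ha hb hab
    rw [hsegment_eq g₀ g₁ a b hab]
    simp only [hΨ]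
    have := (hmain g₀ h₀ g₁ h₁ g' hg').2 (Set.left_mem_Icc.2 zero_le_one)
      (Set.right_mem_Icc.2 zero_le_one) ha hb hab
    simpa using this
end
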